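/- arXiv:1805.04085 — 8 statements merged into one kernel-verified Lean document; each statement's English description precedes it below -/
import Mathlib

section
/- Let G be a nilpotent group of nilpotency class at most 2 and let A be an abelian subgroup of G of finite index n. Then [x,y]^{n²} = 1 for all x, y ∈ G; in particular the commutator subgroup [G,G] has exponent dividing n². -/
open scoped commutatorElement in
/-- Let `G` be nilpotent of class at most 2 (i.e. γ₃(G) = lowerCentralSeries G 2 = ⊥)
and let `A` be an abelian subgroup of finite index `n`. Then `[x,y]^(n²) = 1`
for all `x y : G` (where `[x,y] = x⁻¹y⁻¹xy`), and in particular every element of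
the commutator subgroup `[G,G]` satisfies `g^(n²) = 1`. -/
theorem stmt_2 {G : Type*} [Group G]
    (h2 : (⊤ : Subgroup G).lowerCentralSeries 2 = ⊥)
    (A : Subgroup G) (hA : IsMulCommutative A) (n : ℕ) (hn : A.index = n) (hn0 : n ≠ 0) :
    (∀ x y : G, (x⁻¹ * y⁻¹ * x * y) ^ n ^ 2 = 1) ∧
      (∀ g ∈ commutator G, g ^ n ^ 2 = 1) := by
  have hc : commutator G ≤ Subgroup.center G := by
    intro g hg
    rw [Subgroup.mem_center_iff]
    intro y
    have h1 : ⁅g, y⁆ ∈ (⊤ : Subgroup G).lowerCentralSeries 2 := by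
      have : g ∈ (⊤ : Subgroup G).lowerCentralSeries 1 := by
        rw [commutator_def] at hg
        simpa [Subgroup.lowerCentralSeries] using hg
      exact Subgroup.commutator_mem_commutator this (Subgroup.mem_top y)
    rw [h2, Subgroup.mem_bot, commutatorElement_eq_one_iff_mul_comm] at h1
    exact h1.symm
  have hcz : ∀ x y : G, x⁻¹ * y⁻¹ * x * y ∈ Subgroup.center G := by
    intro x y
    apply hc
    have : ⁅x⁻¹, y⁻¹⁆ ∈ commutator G :=
      Subgroup.commutator_mem_commutator (Subgroup.mem_top _) (Subgroup.mem_top _)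
    simpa [commutatorElement_def] using this
  have hnorm : (A ⊔ Subgroup.center G).Normal := by
    refine ⟨fun b hb g => ?_⟩
    have h1 : ⁅g, b⁆ ∈ A ⊔ Subgroup.center G :=
      le_sup_right (a := A) (hc (Subgroup.commutator_mem_commutator
        (Subgroup.mem_top _) (Subgroup.mem_top _)))
    have h3 := mul_mem h1 hb
    simpa [commutatorElement_def] using h3
  have hAA : A ≤ Subgroup.centralizer (A : Set G) := by
    intro a ha
    rw [Subgroup.mem_centralizer_iff]
    intro b hb
    have := hA.is_comm.comm (⟨b, hb⟩ : A) ⟨a, ha⟩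
    exact congrArg Subtype.val this
  have hBA : A ⊔ Subgroup.center G ≤ Subgroup.centralizer (A : Set G) :=
    sup_le hAA (Subgroup.center_le_centralizer _)
  have hBB : A ⊔ Subgroup.center G ≤
      Subgroup.centralizer ((A ⊔ Subgroup.center G : Subgroup G) : Set G) :=
    sup_le (Subgroup.le_centralizer_iff.mp hBA) (Subgroup.center_le_centralizer _)
  have hpow : ∀ x : G, x ^ n ∈ A ⊔ Subgroup.center G := by
    intro x
    obtain ⟨k, hk⟩ := Subgroup.index_dvd_of_le (le_sup_left : A ≤ A ⊔ Subgroup.center G)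
    rw [← hn, hk, pow_mul]
    exact pow_mem (Subgroup.pow_index_mem _ x) k
  -- if `c` is central and `x * y = y * x * c` then `x ^ k * y = y * x ^ k * c ^ k`
  have key : ∀ x y c : G, c ∈ Subgroup.center G → x * y = y * x * c →
      ∀ k : ℕ, x ^ k * y = y * x ^ k * c ^ k := by
    intro x y c hcc h k
    induction k with
    | zero => simp
    | succ k ih =>
      have hcx : c ^ k * x = x * c ^ k :=
        (Subgroup.mem_center_iff.mp (pow_mem hcc k) x).symm
      calc x ^ (k + 1) * y = x * (x ^ k * y) := by rw [pow_succ' x, mul_assoc]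
        _ = (x * y) * x ^ k * c ^ k := by rw [ih]; simp only [mul_assoc]
        _ = y * x * (c * x ^ k) * c ^ k := by rw [h]; simp only [mul_assoc]
        _ = y * x * (x ^ k * c) * c ^ k := by rw [Subgroup.mem_center_iff.mp hcc (x ^ k)]
        _ = y * x ^ (k + 1) * c ^ (k + 1) := by
          rw [pow_succ' x, pow_succ' c]; simp only [mul_assoc]
  have main : ∀ x y : G, (x⁻¹ * y⁻¹ * x * y) ^ n ^ 2 = 1 := by
    intro x y
    set c := x⁻¹ * y⁻¹ * x * y with hcdef
    have hcc : c ∈ Subgroup.center G := hcz x y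
    have h0 : x * y = y * x * c := by rw [hcdef]; group
    have h1 := key x y c hcc h0 n
    have hd : c ^ n ∈ Subgroup.center G := pow_mem hcc n
    have h3 : y * x ^ n = x ^ n * y * (c ^ n)⁻¹ := by rw [h1]; group
    have h4 := key y (x ^ n) _ (inv_mem hd) h3 n
    have h5 : x ^ n * y ^ n = y ^ n * x ^ n :=
      (Subgroup.mem_centralizer_iff.mp (hBB (hpow y)) _ (hpow x))
    rw [← h5, left_eq_mul, inv_pow, inv_eq_one, ← pow_mul] at h4
    rw [pow_two]; exact h4
  refine ⟨main, fun g hg => ?_⟩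
  have hg' := hg
  rw [commutator_eq_closure] at hg'
  induction hg' using Subgroup.closure_induction with
  | mem z hz =>
    obtain ⟨a, b, rfl⟩ := hz
    have := main a⁻¹ b⁻¹
    simpa [commutatorElement_def] using this
  | one => simp
  | mul a b ha hb iha ihb =>
    rw [← commutator_eq_closure] at ha hb
    have hab : Commute a b := Subgroup.mem_center_iff.mp (hc hb) a
    rw [hab.mul_pow, iha ha, ihb hb, one_mul]
  | inv a ha iha =>
    rw [← commutator_eq_closure] at ha
    rw [inv_pow, iha ha, inv_one]
end

section
/- Let c ≥ 1 and let G be a group generated by a set S. Then G is nilpotent of class at most c if and only if every left-normed commutator [s₁, …, s_{c+1}] of length c+1 with all entries s₁, …, s_{c+1} ∈ S equals 1. -/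
/-- The left-normed commutator of a list of group elements, with the convention
`[x,y] = x⁻¹y⁻¹xy` and `[x₁, …, x_{k+1}] = [[x₁, …, x_k], x_{k+1}]`.
The left-normed commutator of the singleton list `[x]` is `x` itself. -/
def leftNormedComm {G : Type*} [Group G] : List G → G
  | [] => 1
  | x :: xs => xs.foldl (fun a b => a⁻¹ * b⁻¹ * a * b) x

theorem leftNormedComm_concat {G : Type*} [Group G] (l : List G) (hl : l ≠ []) (s : G) :
    leftNormedComm (l ++ [s]) = (leftNormedComm l)⁻¹ * s⁻¹ * leftNormedComm l * s := by
  cases l with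
  | nil => exact absurd rfl hl
  | cons x xs => simp [leftNormedComm, List.foldl_append]

theorem leftNormedComm_mem_lcs {G : Type*} [Group G] (n : ℕ) :
    ∀ l : List G, l.length = n + 1 →
      leftNormedComm l ∈ Subgroup.lowerCentralSeries (⊤ : Subgroup G) n := by
  induction n with
  | zero => intro l _; simp
  | succ n ih =>
    intro l hl
    rcases List.eq_nil_or_concat l with rfl | ⟨l', s, rfl⟩
    · simp at hl
    · have hl' : l'.length = n + 1 := by simpa using hl
      have hne : l' ≠ [] := by rintro rfl; simp at hl'
      rw [List.concat_eq_append, leftNormedComm_concat l' hne, Subgroup.lowerCentralSeries_succ]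
      have h := Subgroup.commutator_mem_commutator (inv_mem (ih l' hl'))
        (Subgroup.mem_top s⁻¹)
      simpa [commutatorElement_def] using h

/-- If a normal subgroup `N` contains all left-normed commutators of length `n + 1` in the
generators, then it contains the corresponding term of the lower central series. -/
theorem lcs_le_of_leftNormedComm_mem {G : Type*} [Group G] (S : Set G)
    (hS : Subgroup.closure S = ⊤) (n : ℕ) :
    ∀ N : Subgroup G, N.Normal →
      (∀ l : List G, l.length = n + 1 → (∀ s ∈ l, s ∈ S) → leftNormedComm l ∈ N) →
      Subgroup.lowerCentralSeries (⊤ : Subgroup G) n ≤ N := by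
  induction n with
  | zero =>
    intro N _ h
    rw [Subgroup.lowerCentralSeries_zero, ← hS, Subgroup.closure_le]
    intro s hs
    simpa [leftNormedComm] using h [s] rfl (by simpa using hs)
  | succ n ih =>
    intro N hN h
    have key := ih ((Subgroup.center (G ⧸ N)).comap (QuotientGroup.mk' N)) inferInstance ?_
    · rw [Subgroup.lowerCentralSeries_succ, Subgroup.commutator_le]
      intro a ha b _
      have hc := Subgroup.mem_center_iff.1 (Subgroup.mem_comap.1 (key ha)) (QuotientGroup.mk' N b)
      rw [← QuotientGroup.eq_one_iff, ← QuotientGroup.mk'_apply, map_commutatorElement,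
        commutatorElement_eq_one_iff_mul_comm]
      exact hc.symm
    · intro l hl hlS
      set x := leftNormedComm l with hx
      have hle : Subgroup.closure S ≤
          (Subgroup.centralizer {QuotientGroup.mk' N x}).comap (QuotientGroup.mk' N) := by
        rw [Subgroup.closure_le]
        intro s hs
        have hm := h (l ++ [s]) (by simp [hl]) (by
          intro t ht
          rcases List.mem_append.1 ht with ht | ht
          · exact hlS t ht
          · rw [List.mem_singleton.1 ht]; exact hs)
        have hne : l ≠ [] := by rintro rfl; simp at hl
        rw [leftNormedComm_concat l hne, ← hx, ← QuotientGroup.eq_one_iff,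
          ← QuotientGroup.mk'_apply] at hm
        simp only [map_mul, map_inv] at hm
        rw [SetLike.mem_coe, Subgroup.mem_comap, Subgroup.mem_centralizer_singleton_iff]
        rw [mul_assoc, ← mul_inv_rev, inv_mul_eq_one] at hm
        exact hm
      rw [hS] at hle
      rw [Subgroup.mem_comap, Subgroup.mem_center_iff]
      intro g
      obtain ⟨g, rfl⟩ := QuotientGroup.mk'_surjective N g
      exact Subgroup.mem_centralizer_singleton_iff.1 (hle (Subgroup.mem_top g))

/-- Let `c ≥ 1` and let `G` be a group generated by a set `S`. Then `G` is nilpotent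
of class at most `c` (i.e. γ_{c+1}(G) = lowerCentralSeries G c = ⊥) if and only if
every left-normed commutator of length `c+1` with all entries in `S` is trivial. -/
theorem stmt_3 {G : Type*} [Group G] (S : Set G) (hS : Subgroup.closure S = ⊤)
    (c : ℕ) (hc : 1 ≤ c) :
    Subgroup.lowerCentralSeries (⊤ : Subgroup G) c = ⊥ ↔
      ∀ l : List G, l.length = c + 1 → (∀ s ∈ l, s ∈ S) → leftNormedComm l = 1 := by
  constructor
  · intro h l hl _
    have := leftNormedComm_mem_lcs c l hl
    rwa [h, Subgroup.mem_bot] at this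
  · intro h
    rw [eq_bot_iff]
    exact lcs_le_of_leftNormedComm_mem S hS c ⊥ inferInstance
      fun l hl hlS => Subgroup.mem_bot.2 (h l hl hlS)
end

section
/- For any group G the following conditions are equivalent: (1) for every c ≥ 1, every nonempty collection of subgroups of G that are nilpotent of class at most c has a maximal element with respect to inclusion; (2) every solvable subgroup of G is finitely generated (equivalently, every solvable subgroup of G is polycyclic); (3) every abelian subgroup of G is finitely generated. -/
/-- Every subgroup is finitely generated. -/
def NG (Γ : Type*) [Group Γ] : Prop := ∀ H : Subgroup Γ, H.FG

theorem NG.of_inj {Γ Δ : Type*} [Group Γ] [Group Δ] (f : Γ →* Δ) (hf : Function.Injective f)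
    (h : NG Δ) : NG Γ := by
  intro H
  have h1 := h (H.map f)
  rw [← Group.fg_iff_subgroup_fg] at h1 ⊢
  exact Group.fg_of_surjective (f := (H.equivMapOfInjective f hf).symm.toMonoidHom)
    (H.equivMapOfInjective f hf).symm.surjective

theorem NG.ext {Γ Δ : Type*} [Group Γ] [Group Δ] (f : Γ →* Δ) (hk : NG f.ker) (h : NG Δ) :
    NG Γ := by
  classical
  intro H
  obtain ⟨S, hS⟩ := h (H.map f)
  have hS' : (S : Set Δ) ⊆ f '' (H : Set Γ) := by
    intro s hs
    have : s ∈ H.map f := hS ▸ Subgroup.subset_closure hs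
    simpa using this
  obtain ⟨T, hT, rfl⟩ := Finset.subset_set_image_iff.1 hS'
  have h2 : (H ⊓ f.ker).FG := by
    have h3 := hk (H.subgroupOf f.ker)
    rw [← Group.fg_iff_subgroup_fg] at h3 ⊢
    have : (H.subgroupOf f.ker).map f.ker.subtype = H ⊓ f.ker := by
      rw [Subgroup.subgroupOf_map_subtype]
    rw [← this]
    exact Group.fg_of_surjective
      (f := ((H.subgroupOf f.ker).equivMapOfInjective f.ker.subtype
        (Subgroup.subtype_injective _)).toMonoidHom) (MulEquiv.surjective _)
  have h4 : H = Subgroup.closure (T : Set Γ) ⊔ (H ⊓ f.ker) := by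
    apply le_antisymm
    · intro x hx
      have h5 : f x ∈ (Subgroup.closure (T : Set Γ)).map f := by
        rw [MonoidHom.map_closure, ← Finset.coe_image, hS]
        exact ⟨x, hx, rfl⟩
      obtain ⟨t, ht, htx⟩ := h5
      have h6 : t ∈ H := (Subgroup.closure_le H).2 hT ht
      have : x = t * (t⁻¹ * x) := by group
      rw [this]
      apply Subgroup.mul_mem_sup ht
      refine ⟨H.mul_mem (H.inv_mem h6) hx, ?_⟩
      simp [htx]
    · exact sup_le ((Subgroup.closure_le H).2 hT) inf_le_left
  rw [h4]
  exact Subgroup.FG.sup ⟨T, rfl⟩ h2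

theorem NG.of_finite {Γ : Type*} [Group Γ] [Finite Γ] : NG Γ := by
  intro H
  rw [← Group.fg_iff_subgroup_fg]
  infer_instance

theorem NG.sub {Γ : Type*} [Group Γ] (h : NG Γ) (H : Subgroup Γ) : NG H :=
  NG.of_inj H.subtype H.subtype_injective h

theorem NG.of_le {Γ : Type*} [Group Γ] {H K : Subgroup Γ} (h : NG K) (hHK : H ≤ K) : NG H :=
  NG.of_inj (Subgroup.inclusion hHK) (Subgroup.inclusion_injective hHK) h

theorem NG.of_finiteIndex {Γ : Type*} [Group Γ] (H : Subgroup Γ) [H.FiniteIndex] (h : NG H) :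
    NG Γ := by
  apply NG.ext (QuotientGroup.mk' H.normalCore)
  · rw [QuotientGroup.ker_mk']
    exact h.of_le H.normalCore_le
  · exact NG.of_finite

theorem NG.of_comm {A : Type*} [CommGroup A] (h : Group.FG A) : NG A := by
  intro H
  have : AddGroup.FG (Additive A) := inferInstance
  have h2 : Module.Finite ℤ (Additive A) := Module.Finite.iff_addGroup_fg.2 this
  have h3 : IsNoetherian ℤ (Additive A) := inferInstance
  have h4 := h3.noetherian (AddSubgroup.toIntSubmodule H.toAddSubgroup)
  rw [Subgroup.fg_iff_add_fg]
  rw [Submodule.fg_iff_addSubgroup_fg] at h4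
  exact h4

theorem NG.of_comm' {A : Type*} [Group A] (hc : ∀ a b : A, a * b = b * a) (h : Group.FG A) :
    NG A := by
  let _ : CommGroup A := { ‹Group A› with mul_comm := hc }
  exact NG.of_comm h

theorem NG.fg {A : Type*} [Group A] (h : NG A) : Group.FG A := ⟨h ⊤⟩

theorem NG.map {Γ Δ : Type*} [Group Γ] [Group Δ] (f : Γ →* Δ) (hf : Function.Surjective f)
    (h : NG Γ) : NG Δ := by
  intro H
  have h1 := h (H.comap f)
  have := Subgroup.map_comap_eq_self_of_surjective hf H
  obtain ⟨S, hS⟩ := h1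
  classical
  refine ⟨S.image f, ?_⟩
  rw [← this, ← hS, MonoidHom.map_closure, Finset.coe_image]

theorem finiteIndex_of_fun {Γ X : Type*} [Group Γ] (H : Subgroup Γ) (f : Γ → X)
    (hf : (Set.range f).Finite) (h : ∀ g k, f g = f k → g⁻¹ * k ∈ H) : H.FiniteIndex := by
  rw [Subgroup.finiteIndex_iff_finite_quotient]
  have : Finite (Set.range f) := hf
  refine Finite.of_injective (fun q : Γ ⧸ H => (⟨f q.out, q.out, rfl⟩ : Set.range f)) ?_
  intro q r hqr
  have h1 : f q.out = f r.out := congrArg Subtype.val hqr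
  have := h _ _ h1
  rw [← QuotientGroup.eq] at this
  simpa using this

/-- stability lemma -/
theorem NG.stab {Γ N : Type*} [Group Γ] [Group N] (φ : Γ →* MulAut N) (A : Subgroup N)
    (hN : Group.FG N) (hA : NG A) (hc : ∀ a ∈ A, ∀ b ∈ A, a * b = b * a)
    (h1 : ∀ γ, ∀ a ∈ A, φ γ a = a) (h2 : ∀ γ n, n⁻¹ * φ γ n ∈ A) (hk : NG φ.ker) : NG Γ := by
  obtain ⟨S, hS⟩ := Group.fg_iff'.1 hN
  obtain ⟨T, -, hT⟩ := hS
  let f : Γ →* (T → A) :=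
    { toFun := fun γ t => ⟨(t : N)⁻¹ * φ γ t, h2 γ t⟩
      map_one' := by
        funext t
        ext
        simp
      map_mul' := by
        intro x y
        funext t
        ext
        have := h1 x _ (h2 y t)
        simp only [map_mul, map_inv, MulAut.mul_apply, Pi.mul_apply, Subgroup.coe_mul] at this ⊢
        have h3 : φ x (φ y t) = φ x t * ((t : N)⁻¹ * φ y t) := by
          rw [← this]; group
        rw [h3]; group }
  have hA' : Group.FG A := hA.fg
  have hcA : ∀ a b : A, a * b = b * a := fun a b => Subtype.ext (hc a a.2 b b.2)
  refine NG.ext f (hk.of_le ?_) (NG.of_comm' (fun a b => funext fun t => hcA _ _) inferInstance)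
  intro γ hγ
  rw [MonoidHom.mem_ker] at hγ ⊢
  have h4 : (φ γ).toMonoidHom = MonoidHom.id N := by
    apply MonoidHom.eq_of_eqOn_dense hT
    intro t ht
    have := congrArg Subtype.val (congrFun hγ ⟨t, ht⟩)
    simp only [f, MonoidHom.coe_mk, OneHom.coe_mk, Pi.one_apply, Subgroup.coe_one] at this
    rw [inv_mul_eq_one] at this
    simp [← this]
  ext n
  exact DFunLike.congr_fun h4 n

/-- restriction of an action to an invariant subgroup -/
def resAut {Γ N : Type*} [Group Γ] [Group N] (φ : Γ →* MulAut N) (A : Subgroup N)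
    (h : ∀ γ, ∀ a ∈ A, φ γ a ∈ A) : Γ →* MulAut A where
  toFun γ :=
    { toFun := fun a => ⟨φ γ a, h γ a a.2⟩
      invFun := fun a => ⟨φ γ⁻¹ a, h γ⁻¹ a a.2⟩
      left_inv := fun a => by ext; simp
      right_inv := fun a => by ext; simp
      map_mul' := fun a b => by ext; simp }
  map_one' := by ext; simp
  map_mul' x y := by ext; simp

/-- induced action on the quotient by an invariant subgroup -/
def quoAut {Γ N : Type*} [Group Γ] [Group N] (φ : Γ →* MulAut N) (A : Subgroup N) [A.Normal]
    (h : ∀ γ, ∀ a ∈ A, φ γ a ∈ A) : Γ →* MulAut (N ⧸ A) where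
  toFun γ :=
    { toFun := QuotientGroup.map A A (φ γ).toMonoidHom (fun a ha => h γ a ha)
      invFun := QuotientGroup.map A A (φ γ⁻¹).toMonoidHom (fun a ha => h γ⁻¹ a ha)
      left_inv := fun a => by
        induction a using QuotientGroup.induction_on; simp
      right_inv := fun a => by
        induction a using QuotientGroup.induction_on; simp
      map_mul' := fun a b => by simp }
  map_one' := by
    ext a; induction a using QuotientGroup.induction_on; simp
  map_mul' x y := by
    ext a; induction a using QuotientGroup.induction_on; simp
section eig
variable {k V : Type*} [Field k] [AddCommGroup V] [Module k V] [FiniteDimensional k V]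

theorem fin_weights {ι : Type*} (f : ι → Module.End k V) (hc : ∀ i j, Commute (f i) (f j)) :
    {χ : ι → k | ∃ v : V, v ≠ 0 ∧ ∀ i, f i v = χ i • v}.Finite := by
  have h1 := Module.End.independent_iInf_maxGenEigenspace_of_forall_mapsTo f
    (fun i j μ => Module.End.mapsTo_maxGenEigenspace_of_comm (hc j i) μ)
  refine (WellFoundedGT.finite_ne_bot_of_iSupIndep h1).subset ?_
  rintro χ ⟨v, hv, h⟩
  rw [Set.mem_ofPred_eq, Submodule.ne_bot_iff]
  refine ⟨v, ?_, hv⟩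
  rw [Module.End.mem_iInf_maxGenEigenspace_iff]
  intro j
  refine ⟨1, ?_⟩
  simp [h j]

theorem common_eig [IsAlgClosed k] [Nontrivial V] {ι : Type*} (f : ι → Module.End k V)
    (hc : ∀ i j, Commute (f i) (f j)) : ∃ (χ : ι → k) (v : V), v ≠ 0 ∧ ∀ i, f i v = χ i • v := by
  let P : Set (Submodule k V) := {W | W ≠ ⊥ ∧ ∀ i, ∀ w ∈ W, f i w ∈ W}
  have hP : P.Nonempty := ⟨⊤, top_ne_bot, fun _ _ _ => trivial⟩
  obtain ⟨W, ⟨hW, hWi⟩, hmin⟩ := (wellFounded_lt (α := Submodule k V)).has_min P hP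
  have key : ∀ i, ∃ c : k, ∀ w ∈ W, f i w = c • w := by
    intro i
    have : Nontrivial W := Submodule.nontrivial_iff_ne_bot.2 hW
    obtain ⟨c, hc'⟩ := Module.End.exists_eigenvalue ((f i).restrict (hWi i))
    obtain ⟨v, hv⟩ := hc'.exists_hasEigenvector
    refine ⟨c, ?_⟩
    let U : Submodule k V := W ⊓ (f i).eigenspace c
    have hU : U ∈ P := by
      constructor
      · rw [Submodule.ne_bot_iff]
        refine ⟨v, ⟨v.2, ?_⟩, ?_⟩
        · simp only [SetLike.mem_coe, Module.End.mem_eigenspace_iff]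
          exact congrArg Subtype.val hv.apply_eq_smul
        · simpa using hv.2
      · rintro j w ⟨hw1, hw2⟩
        refine ⟨hWi j w hw1, ?_⟩
        simp only [SetLike.mem_coe, Module.End.mem_eigenspace_iff] at hw2 ⊢
        have := LinearMap.congr_fun (hc i j) w
        simp only [Module.End.mul_apply] at this
        rw [this, hw2, map_smul]
    have hUW : U = W := by
      by_contra hne
      exact hmin U hU (lt_of_le_of_ne inf_le_left hne)
    intro w hw
    rw [← hUW] at hw
    exact Module.End.mem_eigenspace_iff.1 hw.2
  choose χ hχ using key
  obtain ⟨v, hv, hv0⟩ := (Submodule.ne_bot_iff _).1 hW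
  exact ⟨χ, v, hv0, fun i => hχ i v hv⟩

/-- Strong irreducibility. -/
def SI {Γ : Type*} [Group Γ] (ρ : Γ →* Module.End k V) : Prop :=
  ∀ H : Subgroup Γ, H.FiniteIndex → ∀ W : Submodule k V,
    (∀ γ ∈ H, ∀ w ∈ W, ρ γ w ∈ W) → W = ⊥ ∨ W = ⊤

theorem SI.sub {Γ : Type*} [Group Γ] {ρ : Γ →* Module.End k V} (h : SI ρ) (Δ : Subgroup Γ)
    [hΔ : Δ.FiniteIndex] : SI (ρ.comp Δ.subtype) := by
  intro H hH W hW
  refine h (H.map Δ.subtype) ?_ W ?_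
  · rw [Subgroup.finiteIndex_iff, Subgroup.index_map_subtype]
    exact mul_ne_zero hH.index_ne_zero hΔ.index_ne_zero
  · rintro _ ⟨γ, hγ, rfl⟩ w hw
    exact hW γ hγ w hw

theorem SI.abelian [IsAlgClosed k] [Nontrivial V] {Γ : Type*} [Group Γ]
    {ρ : Γ →* Module.End k V} (h : SI ρ) (A : Subgroup Γ) [hA : A.Normal]
    (hc : ∀ a ∈ A, ∀ b ∈ A, ρ a * ρ b = ρ b * ρ a) : ∀ a ∈ A, ∃ c : k, ρ a = c • 1 := by
  have hcomm : ∀ i j : A, Commute (ρ i) (ρ j) := fun i j => hc i i.2 j j.2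
  obtain ⟨χ, v, hv, hχ⟩ := common_eig (fun a : A => ρ a) hcomm
  have hfin := fin_weights (fun a : A => ρ a) hcomm
  let cj : Γ → A → A := fun γ a => ⟨γ⁻¹ * a * γ, by
    simpa using hA.conj_mem a a.2 γ⁻¹⟩
  let F : Γ → (A → k) := fun γ a => χ (cj γ a)
  have cj_mul : ∀ γ δ a, cj (γ * δ) a = cj δ (cj γ a) := by
    intro γ δ a; ext; simp [cj, mul_assoc]
  have cj_one : ∀ a, cj 1 a = a := by
    intro a; ext; simp [cj]
  let H : Subgroup Γ :=
    { carrier := {γ | F γ = χ}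
      one_mem' := by funext a; simp [F, cj_one]
      mul_mem' := by
        intro x y hx hy
        funext a
        have h1 := congrFun hy (cj x a)
        have h2 := congrFun hx a
        simp only [F] at h1 h2 ⊢
        rw [cj_mul, h1, h2]
      inv_mem' := by
        intro x hx
        funext a
        have h2 := congrFun hx (cj x⁻¹ a)
        simp only [F] at h2 ⊢
        rw [← h2, ← cj_mul]
        simp [cj_one] }
  have hmemH : ∀ γ, γ ∈ H ↔ F γ = χ := fun γ => Iff.rfl
  have hH : H.FiniteIndex := by
    refine finiteIndex_of_fun H F (hfin.subset ?_) ?_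
    · rintro _ ⟨γ, rfl⟩
      refine ⟨ρ γ v, ?_, ?_⟩
      · intro h0
        apply hv
        have : ρ γ⁻¹ (ρ γ v) = v := by
          rw [← Module.End.mul_apply, ← map_mul]; simp
        rw [← this, h0, map_zero]
      · intro a
        have h1 := hχ (cj γ a)
        have h2 : (a : Γ) * γ = γ * (cj γ a : A) := by simp [cj, mul_assoc]
        simp only [F]
        rw [← Module.End.mul_apply, ← map_mul, h2, map_mul, Module.End.mul_apply, h1, map_smul]
    · intro g l hgl
      rw [hmemH]
      funext a
      have := congrFun hgl (cj g⁻¹ a)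
      simp only [F] at this ⊢
      rw [cj_mul, ← this, ← cj_mul]
      simp [cj_one]
  let W : Submodule k V := ⨅ a : A, (ρ a).eigenspace (χ a)
  have hW : ∀ w, w ∈ W ↔ ∀ a : A, ρ a w = χ a • w := by
    intro w; simp [W]
  have hinv : ∀ γ ∈ H, ∀ w ∈ W, ρ γ w ∈ W := by
    intro γ hγ w hw
    rw [hW] at hw ⊢
    intro a
    have h1 := hw (cj γ a)
    have h2 : (a : Γ) * γ = γ * (cj γ a : A) := by simp [cj, mul_assoc]
    have h3 := congrFun ((hmemH γ).1 hγ) a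
    simp only [F] at h3
    rw [← Module.End.mul_apply, ← map_mul, h2, map_mul, Module.End.mul_apply, h1, map_smul, h3]
  rcases h H hH W hinv with h1 | h1
  · exact absurd ((Submodule.mem_bot k).1 (h1 ▸ (hW v).2 hχ)) hv
  · intro a ha
    refine ⟨χ ⟨a, ha⟩, ?_⟩
    ext w
    have : w ∈ W := h1 ▸ trivial
    simpa using (hW w).1 this ⟨a, ha⟩

end eig
section eig2
variable {k V : Type*} [Field k] [AddCommGroup V] [Module k V] [FiniteDimensional k V]
variable {Γ : Type*} [Group Γ]

/-- elements whose image commutes with the image of `x` -/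
def commSub (ρ : Γ →* Module.End k V) (x : Γ) : Subgroup Γ where
  carrier := {γ | Commute (ρ γ) (ρ x)}
  one_mem' := by
    change Commute _ _
    rw [map_one]; exact Commute.one_left _
  mul_mem' := by
    intro a b ha hb
    change Commute _ _
    rw [map_mul]; exact Commute.mul_left ha hb
  inv_mem' := by
    intro a ha
    change ρ a⁻¹ * ρ x = ρ x * ρ a⁻¹
    have h : ρ a * ρ x = ρ x * ρ a := ha
    have h1 : ρ a⁻¹ * (ρ a * ρ x) * ρ a⁻¹ = ρ a⁻¹ * (ρ x * ρ a) * ρ a⁻¹ := by rw [h]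
    simp only [← map_mul] at h1 ⊢
    simpa [mul_assoc] using h1.symm

theorem mem_commSub {ρ : Γ →* Module.End k V} {x γ : Γ} :
    γ ∈ commSub ρ x ↔ ρ (γ * x) = ρ (x * γ) := by
  rw [map_mul, map_mul]; exact Iff.rfl

theorem rho_ne_zero [Nontrivial V] (ρ : Γ →* Module.End k V) (x : Γ) : ρ x ≠ 0 := by
  intro h
  have : ρ (x * x⁻¹) = 0 := by rw [map_mul, h, zero_mul]
  rw [mul_inv_cancel, map_one] at this
  exact one_ne_zero this

theorem SI.centralize [IsAlgClosed k] [Nontrivial V]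
    {ρ : Γ →* Module.End k V} (h : SI ρ) (B : Subgroup Γ) [hBn : B.Normal]
    (hB : ∀ b ∈ B, ∀ c ∈ B, ∃ s : k, ρ (b * c) = s • ρ (c * b)) :
    ∃ Δ : Subgroup Γ, Δ.FiniteIndex ∧ ∀ γ ∈ Δ, ∀ b ∈ B, ρ γ * ρ b = ρ b * ρ γ := by
  classical
  have hB' : ∀ b c : B, ∃ s : k, ρ (c * b) = s • ρ (b * c) := fun b c => hB c c.2 b b.2
  choose lam hlam using hB'
  have hlam0 : ∀ b c, lam b c ≠ 0 := by
    intro b c h0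
    have := hlam b c
    rw [h0, zero_smul] at this
    exact rho_ne_zero ρ _ this
  -- finitely many weights
  let Cj : B → Module.End k (Module.End k V) := fun c =>
    LinearMap.mulLeft k (ρ c) * LinearMap.mulRight k (ρ (c : Γ)⁻¹)
  have hCj : ∀ c T, Cj c T = ρ c * T * ρ (c : Γ)⁻¹ := by
    intro c T; simp [Cj, mul_assoc]
  have hcomm : ∀ b c, Commute (Cj b) (Cj c) := by
    intro b c
    refine LinearMap.ext fun T => ?_
    simp only [Module.End.mul_apply, hCj]
    have h1 := hlam c b
    set s := lam c b
    have e1 : ρ b * (ρ c * T * ρ (c : Γ)⁻¹) * ρ (b : Γ)⁻¹ = ρ (b * c) * T * ρ ((b * c : Γ)⁻¹) := by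
      simp [mul_assoc]
    have e2 : ρ c * (ρ b * T * ρ (b : Γ)⁻¹) * ρ (c : Γ)⁻¹ = ρ (c * b) * T * ρ ((c * b : Γ)⁻¹) := by
      simp [mul_assoc]
    have e3 : ρ ((c * b : Γ)⁻¹) = s • ρ ((b * c : Γ)⁻¹) := by
      have : ρ ((c * b : Γ)⁻¹) * ρ (b * c) * ρ ((b * c : Γ)⁻¹) =
        ρ ((c * b : Γ)⁻¹) * (s • ρ (c * b)) * ρ ((b * c : Γ)⁻¹) := by rw [h1]
      rw [mul_smul_comm, smul_mul_assoc] at this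
      simp only [← map_mul] at this
      simpa [-map_mul, mul_assoc] using this
    rw [e1, e2, e3, h1]
    simp
  have hfin : (Set.range lam).Finite := by
    refine (fin_weights Cj hcomm).subset ?_
    rintro _ ⟨b, rfl⟩
    refine ⟨ρ b, rho_ne_zero ρ b, fun c => ?_⟩
    rw [hCj, ← map_mul, hlam, smul_mul_assoc, ← map_mul]
    simp
  -- the centre
  let B0 : Subgroup Γ := B ⊓ ⨅ c : B, commSub ρ c
  have hB0 : ∀ x, x ∈ B0 ↔ x ∈ B ∧ ∀ c : B, ρ (x * c) = ρ (c * x) := by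
    intro x
    simp only [B0, Subgroup.mem_inf, Subgroup.mem_iInf, mem_commSub]
  have hB0n : B0.Normal := by
    constructor
    intro n hn g
    rw [hB0] at hn ⊢
    refine ⟨hBn.conj_mem n hn.1 g, fun c => ?_⟩
    have h1 := hn.2 ⟨g⁻¹ * c * g, by simpa using hBn.conj_mem c c.2 g⁻¹⟩
    simp only at h1
    have h2 : ρ g * ρ (n * (g⁻¹ * c * g)) * ρ g⁻¹ = ρ g * ρ (g⁻¹ * c * g * n) * ρ g⁻¹ := by rw [h1]
    simp only [← map_mul] at h2
    simpa [-map_mul, mul_assoc] using h2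
  have hsc := h.abelian B0 (fun a ha b hb => by
    have := ((hB0 a).1 ha).2 ⟨b, ((hB0 b).1 hb).1⟩
    simpa [map_mul] using this)
  -- same weight implies proportional
  have hprop : ∀ b b' : B, lam b = lam b' → ∃ s : k, ρ b' = s • ρ b := by
    intro b b' hbb
    have hmem : (b : Γ)⁻¹ * b' ∈ B0 := by
      rw [hB0]
      refine ⟨B.mul_mem (B.inv_mem b.2) b'.2, fun c => ?_⟩
      have h1 := hlam b c
      have h2 := hlam b' c
      rw [← hbb] at h2
      have h3 : ρ (b : Γ)⁻¹ * ρ (c * b) * ρ ((b : Γ)⁻¹ * b') =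
        ρ (b : Γ)⁻¹ * (lam b c • ρ (b * c)) * ρ ((b : Γ)⁻¹ * b') := by rw [h1]
      have h4 : ρ (b : Γ)⁻¹ * ρ (c * b') = ρ (b : Γ)⁻¹ * (lam b c • ρ (b' * c)) := by rw [h2]
      rw [mul_smul_comm] at h3 h4
      rw [smul_mul_assoc] at h3
      simp only [← map_mul] at h3 h4
      have h5 : lam b c • ρ ((b : Γ)⁻¹ * b' * c) = lam b c • ρ (c * ((b : Γ)⁻¹ * b')) := by
        rw [← mul_assoc] at h4
        simp only [mul_assoc] at h3 h4 ⊢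
        simp only [mul_inv_cancel_left, inv_mul_cancel_left] at h3
        rw [← h4, ← h3]
      exact smul_right_injective _ (hlam0 b c) h5
    obtain ⟨s, hs⟩ := hsc _ hmem
    refine ⟨s, ?_⟩
    have : ρ b * ρ ((b : Γ)⁻¹ * b') = ρ b * (s • 1) := by rw [hs]
    rw [← map_mul] at this
    simpa [-map_mul] using this
  have hn : 0 < Module.finrank k V := Module.finrank_pos
  have hdet0 : ∀ x, LinearMap.det (ρ x) ≠ 0 := by
    intro x hx
    have : LinearMap.det (ρ (x * x⁻¹)) = 0 := by rw [map_mul, map_mul, hx, zero_mul]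
    simp at this
  have hfinO : ∀ d : k, {T | ∃ b : B, T = ρ b ∧ LinearMap.det (ρ b) = d}.Finite := by
    intro d
    have h1 : ∀ χ ∈ Set.range lam,
        {T | ∃ b : B, T = ρ b ∧ LinearMap.det (ρ b) = d ∧ lam b = χ}.Finite := by
      intro χ _
      by_cases hex : ∃ b0 : B, LinearMap.det (ρ b0) = d ∧ lam b0 = χ
      · obtain ⟨b0, hb0, hb0'⟩ := hex
        refine (((Polynomial.nthRoots (Module.finrank k V) (1 : k)).toFinset.finite_toSet).image
          (fun s : k => s • ρ b0)).subset ?_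
        rintro _ ⟨b, rfl, hb, hb'⟩
        obtain ⟨s, hs⟩ := hprop b0 b (hb0'.trans hb'.symm)
        refine ⟨s, ?_, hs.symm⟩
        simp only [Finset.mem_coe, Multiset.mem_toFinset, Polynomial.mem_nthRoots hn]
        rw [hs, LinearMap.det_smul, ← hb0] at hb
        exact mul_right_cancel₀ (hdet0 b0) (by rw [hb, one_mul])
      · convert Set.finite_empty
        ext T
        simp only [Set.mem_ofPred_eq, Set.mem_empty_iff_false, iff_false]
        rintro ⟨b, -, hb⟩
        exact hex ⟨b, hb⟩
    refine (hfin.biUnion h1).subset ?_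
    rintro _ ⟨b, rfl, hb⟩
    simp only [Set.mem_iUnion]
    exact ⟨lam b, ⟨b, rfl⟩, b, rfl, hb, rfl⟩
  have hfi : ∀ b : B, (commSub ρ (b : Γ)).FiniteIndex := by
    intro b
    refine finiteIndex_of_fun _ (fun γ => ρ (γ * b * γ⁻¹))
      ((hfinO (LinearMap.det (ρ b))).subset ?_) ?_
    · rintro _ ⟨γ, rfl⟩
      refine ⟨⟨γ * b * γ⁻¹, hBn.conj_mem b b.2 γ⟩, rfl, ?_⟩
      have h1 : LinearMap.det (ρ γ) * LinearMap.det (ρ γ⁻¹) = 1 := by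
        rw [← map_mul, ← map_mul]; simp
      simp only [map_mul]
      rw [mul_right_comm, h1, one_mul]
    · intro g l hgl
      rw [mem_commSub]
      have : ρ g⁻¹ * ρ (g * b * g⁻¹) * ρ l = ρ g⁻¹ * ρ (l * b * l⁻¹) * ρ l := by
        have hgl' : ρ (g * b * g⁻¹) = ρ (l * b * l⁻¹) := hgl
        rw [hgl']
      simp only [← map_mul] at this
      simpa [-map_mul, mul_assoc] using this.symm
  obtain ⟨t, hts, htspan, htli⟩ := exists_linearIndependent k (ρ '' (B : Set Γ))
  have htf : Finite t := htli.finite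
  choose g hgB hg using hts
  refine ⟨⨅ T : t, commSub ρ (g T.2), Subgroup.finiteIndex_iInf fun T => hfi ⟨g T.2, hgB T.2⟩, ?_⟩
  intro γ hγ b hb
  have hb1 : ρ b ∈ Submodule.span k t := by
    rw [htspan]; exact Submodule.subset_span ⟨b, hb, rfl⟩
  generalize ρ b = T0 at hb1 ⊢
  induction hb1 using Submodule.span_induction with
  | mem T hT =>
    have := (Subgroup.mem_iInf.1 hγ) ⟨T, hT⟩
    rw [mem_commSub, map_mul, map_mul, hg hT] at this
    exact this
  | zero => simp
  | add x y _ _ hx hy => rw [mul_add, add_mul, hx, hy]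
  | smul a x _ hx => rw [mul_smul_comm, smul_mul_assoc, hx]

end eig2
section eig3
universe u
variable {k V : Type*} [Field k] [AddCommGroup V] [Module k V] [FiniteDimensional k V]

theorem SI.virt_scalar [IsAlgClosed k] [Nontrivial V] (d : ℕ) :
    ∀ (Γ : Type u) [Group Γ] (ρ : Γ →* Module.End k V), SI ρ →
      (∀ x ∈ derivedSeries Γ d, ∃ c : k, ρ x = c • 1) →
      ∃ Δ : Subgroup Γ, Δ.FiniteIndex ∧ ∀ γ ∈ Δ, ∃ c : k, ρ γ = c • 1 := by
  induction d with
  | zero =>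
    intro Γ _ ρ _ h
    exact ⟨⊤, inferInstance, fun γ hγ => h γ (by simp)⟩
  | succ d ih =>
    intro Γ _ ρ hSI h
    have hnorm : (derivedSeries Γ d).Normal := derivedSeries_normal Γ d
    obtain ⟨Δ, hΔ, hcom⟩ := hSI.centralize (derivedSeries Γ d) (by
      intro b hb c hc
      obtain ⟨s, hs⟩ := h (b * c * b⁻¹ * c⁻¹) (by
        rw [derivedSeries_succ]; exact Subgroup.commutator_mem_commutator hb hc)
      refine ⟨s, ?_⟩
      have : b * c = (b * c * b⁻¹ * c⁻¹) * (c * b) := by simp [mul_assoc]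
      rw [this, map_mul, hs]
      simp)
    have hnorm2 : (derivedSeries Δ d).Normal := derivedSeries_normal Δ d
    have hle : ∀ x ∈ derivedSeries Δ d, (x : Γ) ∈ derivedSeries Γ d := fun x hx =>
      map_derivedSeries_le_derivedSeries Δ.subtype d ⟨x, hx, rfl⟩
    have hsc := hSI.sub Δ |>.abelian (derivedSeries Δ d) (by
      intro a ha b hb
      exact hcom a a.2 b (hle b hb))
    obtain ⟨E, hE, hE2⟩ := ih Δ (ρ.comp Δ.subtype) (hSI.sub Δ) hsc
    refine ⟨E.map Δ.subtype, ?_, ?_⟩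
    · rw [Subgroup.finiteIndex_iff, Subgroup.index_map_subtype]
      exact mul_ne_zero hE.index_ne_zero hΔ.index_ne_zero
    · rintro _ ⟨γ, hγ, rfl⟩
      exact hE2 γ hγ

theorem virt_eig [IsAlgClosed k] [Nontrivial V] (Γ : Type u) [Group Γ] [hs : Group.IsSolvable Γ]
    (ρ : Γ →* Module.End k V) :
    ∃ Δ : Subgroup Γ, Δ.FiniteIndex ∧ ∃ v : V, v ≠ 0 ∧ ∀ γ ∈ Δ, ∃ c : k, ρ γ v = c • v := by
  let P : Set (Submodule k V) := {W | W ≠ ⊥ ∧ ∃ H : Subgroup Γ, H.FiniteIndex ∧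
    ∀ γ ∈ H, ∀ w ∈ W, ρ γ w ∈ W}
  have hP : P.Nonempty := ⟨⊤, top_ne_bot, ⊤, inferInstance, fun _ _ _ _ => trivial⟩
  obtain ⟨W, ⟨hW, H, hH, hHW⟩, hmin⟩ := (wellFounded_lt (α := Submodule k V)).has_min P hP
  have : Nontrivial W := Submodule.nontrivial_iff_ne_bot.2 hW
  let ρ' : H →* Module.End k W :=
    { toFun := fun γ => (ρ γ).restrict (hHW γ γ.2)
      map_one' := by ext; simp
      map_mul' := by intro x y; ext; simp }
  have hρ' : ∀ γ w, (ρ' γ w : V) = ρ γ w := fun γ w => rfl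
  have hSI : SI ρ' := by
    intro E hE U hU
    by_contra hcon
    push Not at hcon
    refine hmin (U.map W.subtype) ⟨?_, E.map H.subtype, ?_, ?_⟩ ?_
    · intro h0
      apply hcon.1
      rw [eq_bot_iff]
      intro x hx
      have hx' : (x : V) ∈ U.map W.subtype := ⟨x, hx, rfl⟩
      rw [h0, Submodule.mem_bot] at hx'
      simpa using hx'
    · rw [Subgroup.finiteIndex_iff, Subgroup.index_map_subtype]
      exact mul_ne_zero hE.index_ne_zero hH.index_ne_zero
    · rintro _ ⟨γ, hγ, rfl⟩ _ ⟨w, hw, rfl⟩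
      exact ⟨ρ' γ w, hU γ hγ w hw, rfl⟩
    · refine lt_of_le_of_ne (Submodule.map_subtype_le W U) ?_
      intro h0
      apply hcon.2
      rw [eq_top_iff]
      intro w _
      have : (w : V) ∈ U.map W.subtype := by rw [h0]; exact w.2
      obtain ⟨w', hw', hww⟩ := this
      have : w' = w := Subtype.ext hww
      exact this ▸ hw'
  have hsH : Group.IsSolvable H := inferInstance
  obtain ⟨d, hd⟩ := (Group.isSolvable_def H).1 hsH
  obtain ⟨E, hE, hE2⟩ := SI.virt_scalar d H ρ' hSI (by
    intro x hx
    rw [hd, Subgroup.mem_bot] at hx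
    exact ⟨1, by simp [hx]⟩)
  obtain ⟨v, hv⟩ := exists_ne (0 : W)
  refine ⟨E.map H.subtype, ?_, v, by simpa using hv, ?_⟩
  · rw [Subgroup.finiteIndex_iff, Subgroup.index_map_subtype]
    exact mul_ne_zero hE.index_ne_zero hH.index_ne_zero
  · rintro _ ⟨γ, hγ, rfl⟩
    obtain ⟨c, hc⟩ := hE2 γ hγ
    refine ⟨c, ?_⟩
    have := congrArg Subtype.val (LinearMap.congr_fun hc v)
    rw [hρ'] at this
    simpa using this

end eig3
theorem NG.of_char {Γ : Type*} [Group Γ] (χ : Γ →* ℂˣ) (M : AddSubgroup ℂ) (hM : M.FG)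
    (m : ℂ) (hm : m ∈ M) (hm0 : m ≠ 0) (h : ∀ γ, ∀ x ∈ M, (χ γ : ℂ) * x ∈ M) (hk : NG χ.ker) :
    NG Γ := by
  classical
  let N : Submodule ℤ ℂ := AddSubgroup.toIntSubmodule M
  have hN : N.FG := by
    rw [Submodule.fg_iff_addSubgroup_fg]; exact hM
  have hIntegral : ∀ γ, IsIntegral ℤ (χ γ : ℂ) := by
    intro γ
    refine isIntegral_of_smul_mem_submodule N ?_ hN (χ γ : ℂ) (fun n hn => h γ n hn)
    rw [Submodule.ne_bot_iff]
    exact ⟨m, hm, hm0⟩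
  let S : Set ℂ := Set.range (fun γ => (χ γ : ℂ))
  have hNn : IsNoetherian ℤ N := isNoetherian_of_fg_of_noetherian N hN
  let f : Submodule.span ℤ S →ₗ[ℤ] N :=
    ((LinearMap.mulRight ℤ m).restrict (p := Submodule.span ℤ S) (q := N) (by
      intro x hx
      induction hx using Submodule.span_induction with
      | mem x hx =>
        obtain ⟨γ, rfl⟩ := hx
        exact h γ m hm
      | zero => simp
      | add x y _ _ hx hy => rw [map_add]; exact N.add_mem hx hy
      | smul a x _ hx => rw [map_smul]; exact N.smul_mem a hx))
  have hf : Function.Injective f := by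
    intro x y hxy
    have h1 : (x : ℂ) * m = y * m := congrArg Subtype.val hxy
    exact Subtype.ext (mul_right_cancel₀ hm0 h1)
  have hSn : IsNoetherian ℤ (Submodule.span ℤ S) := isNoetherian_of_injective f hf
  have hSfg : (Submodule.span ℤ S).FG := by
    rw [← Module.Finite.iff_fg]; infer_instance
  obtain ⟨S0, hS0, hspan⟩ := (Submodule.fg_span_iff_fg_span_finset_subset S).1 hSfg
  let K : IntermediateField ℚ ℂ := IntermediateField.adjoin ℚ (S0 : Set ℂ)
  have hfd : FiniteDimensional ℚ K := by
    apply IntermediateField.finiteDimensional_adjoin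
    intro x hx
    obtain ⟨γ, rfl⟩ := hS0 hx
    exact (hIntegral γ).tower_top
  have hnf : NumberField K := { to_charZero := inferInstance, to_finiteDimensional := hfd }
  have hmem : ∀ γ, (χ γ : ℂ) ∈ K := by
    intro γ
    have h1 : (χ γ : ℂ) ∈ Submodule.span ℤ (S0 : Set ℂ) := by
      rw [← hspan]; exact Submodule.subset_span ⟨γ, rfl⟩
    generalize (χ γ : ℂ) = z at h1 ⊢
    induction h1 using Submodule.span_induction with
    | mem x hx => exact IntermediateField.subset_adjoin ℚ _ hx
    | zero => exact K.zero_mem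
    | add x y _ _ hx hy => exact K.add_mem hx hy
    | smul a x _ hx => exact K.zsmul_mem hx a
  have hIntegralB : ∀ γ, IsIntegral ℤ (⟨χ γ, hmem γ⟩ : K) := by
    intro γ
    have := hIntegral γ
    rw [← isIntegral_algebraMap_iff (B := ℂ) (A := K) (algebraMap K ℂ).injective]
    exact this
  let ψ0 : Γ →* NumberField.RingOfIntegers K :=
    { toFun := fun γ => ⟨⟨χ γ, hmem γ⟩, hIntegralB γ⟩
      map_one' := by
        apply NumberField.RingOfIntegers.ext; apply Subtype.ext; simp
      map_mul' := by
        intro x y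
        apply NumberField.RingOfIntegers.ext; apply Subtype.ext
        change ((χ (x * y) : ℂˣ) : ℂ) = (χ x : ℂ) * (χ y : ℂ)
        simp }
  refine NG.ext ψ0.toHomUnits (hk.of_le ?_) (NG.of_comm (Group.fg_iff_monoid_fg.2 inferInstance))
  intro γ hγ
  rw [MonoidHom.mem_ker] at hγ ⊢
  have h1 : ψ0 γ = 1 := congrArg Units.val hγ
  have h2 : (χ γ : ℂ) = 1 := congrArg (fun z : NumberField.RingOfIntegers K => ((z : K) : ℂ)) h1
  exact Units.ext h2
theorem NG.ker_comp {Γ Δ : Type*} [Group Γ] [Group Δ] (φ : Γ →* Δ) (H : Subgroup Γ)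
    (h : NG φ.ker) : NG (φ.comp H.subtype).ker := by
  let f : (φ.comp H.subtype).ker →* φ.ker :=
    { toFun := fun x => ⟨((x : H) : Γ), x.2⟩
      map_one' := rfl
      map_mul' := fun _ _ => rfl }
  refine NG.of_inj f ?_ h
  intro x y hxy
  exact Subtype.ext (Subtype.ext (congrArg (fun z : φ.ker => (z : Γ)) hxy))

theorem finite_or_hom (A : Type*) [AddCommGroup A] [AddGroup.FG A] :
    Finite A ∨ Nontrivial (A →+ ℂ) := by
  classical
  obtain ⟨n, ι, fι, p, hp, e, ⟨E⟩⟩ := AddCommGroup.equiv_free_prod_directSum_zmod A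
  rcases Nat.eq_zero_or_pos n with rfl | hn
  · left
    have : ∀ i, NeZero (p i ^ e i) := fun i => ⟨pow_ne_zero _ (hp i).ne_zero⟩
    have h1 : Finite (DirectSum ι fun i => ZMod (p i ^ e i)) :=
      Finite.of_equiv _ (DirectSum.addEquivProd (fun i => ZMod (p i ^ e i))).symm.toEquiv
    exact Finite.of_equiv _ E.symm.toEquiv
  · right
    let f : A →+ ℂ := (Int.castAddHom ℂ).comp
      ((Finsupp.applyAddHom (⟨0, hn⟩ : Fin n)).comp ((AddMonoidHom.fst _ _).comp E.toAddMonoidHom))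
    refine ⟨⟨f, 0, fun h => ?_⟩⟩
    have := DFunLike.congr_fun h (E.symm (Finsupp.single ⟨0, hn⟩ 1, 0))
    simp [f] at this

theorem finDim_hom (A : Type*) [AddCommGroup A] [hA : AddGroup.FG A] :
    FiniteDimensional ℂ (A →+ ℂ) := by
  obtain ⟨T, hT⟩ := hA.1
  let g : (A →+ ℂ) →ₗ[ℂ] (T → ℂ) :=
    { toFun := fun f t => f t
      map_add' := fun _ _ => rfl
      map_smul' := fun _ _ => rfl }
  refine FiniteDimensional.of_injective g ?_
  intro f f' hff
  refine AddMonoidHom.eq_of_eqOn_dense hT ?_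
  intro t ht
  exact congrFun hff ⟨t, ht⟩

theorem NG.aut_ab (n : ℕ) : ∀ (A : Type*) [CommGroup A] [Group.FG A],
    Module.finrank ℤ (Additive A) < n → ∀ (Γ : Type*) [Group Γ] [Group.IsSolvable Γ]
      (φ : Γ →* MulAut A), NG φ.ker → NG Γ := by
  induction n with
  | zero => intro A _ _ h; exact absurd h (Nat.not_lt_zero _)
  | succ n ih =>
  intro A _ hAfg hn Γ _ _ φ hk
  rcases finite_or_hom (Additive A) with hfin | hnt
  · have hfA : Finite A := hfin
    have : Finite (MulAut A) :=
      Finite.of_injective (fun f : MulAut A => (f : A → A)) DFunLike.coe_injective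
    exact NG.ext φ hk NG.of_finite
  have hfd := finDim_hom (Additive A)
  let ρ : Γ →* Module.End ℂ (Additive A →+ ℂ) :=
    { toFun := fun γ =>
        { toFun := fun f => f.comp (MonoidHom.toAdditive (φ γ⁻¹).toMonoidHom)
          map_add' := fun _ _ => rfl
          map_smul' := fun _ _ => rfl }
      map_one' := by
        refine LinearMap.ext fun f => AddMonoidHom.ext fun x => ?_
        simp
      map_mul' := by
        intro x y
        refine LinearMap.ext fun f => AddMonoidHom.ext fun z => ?_
        simp }
  have hρ : ∀ γ f (a : A), ρ γ f (Additive.ofMul a) = f (Additive.ofMul (φ γ⁻¹ a)) :=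
    fun _ _ _ => rfl
  obtain ⟨Δ, hΔ, f, hf0, hf⟩ := virt_eig Γ ρ
  have hf' : ∀ γ : Δ, ∃ c : ℂ, ∀ a : A, f (Additive.ofMul (φ γ a)) = c * f (Additive.ofMul a) := by
    intro γ
    obtain ⟨c, hc⟩ := hf _ (Δ.inv_mem γ.2)
    refine ⟨c, fun a => ?_⟩
    have := DFunLike.congr_fun hc (Additive.ofMul a)
    rw [hρ, inv_inv] at this
    exact this
  choose c hc using hf'
  have hx : ∃ a : A, f (Additive.ofMul a) ≠ 0 := by
    by_contra hcon
    push Not at hcon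
    exact hf0 (AddMonoidHom.ext hcon)
  obtain ⟨a0, ha0⟩ := hx
  let χ0 : Δ →* ℂ :=
    { toFun := c
      map_one' := by
        have := hc 1 a0
        apply mul_right_cancel₀ ha0
        rw [← this]; simp
      map_mul' := by
        intro x y
        apply mul_right_cancel₀ ha0
        rw [← hc, mul_assoc, ← hc, ← hc]
        simp }
  let χ : Δ →* ℂˣ := χ0.toHomUnits
  have hχ : ∀ (γ : Δ) (a : A), f (Additive.ofMul (φ γ a)) = (χ γ : ℂ) * f (Additive.ofMul a) := hc
  let F : Subgroup A :=
    { carrier := {a | f (Additive.ofMul a) = 0}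
      one_mem' := by simp
      mul_mem' := by
        intro a b ha hb
        simp only [Set.mem_ofPred_eq] at ha hb ⊢
        rw [ofMul_mul, map_add, ha, hb, add_zero]
      inv_mem' := by
        intro a ha
        simp only [Set.mem_ofPred_eq] at ha ⊢
        rw [ofMul_inv, map_neg, ha, neg_zero] }
  have hF : ∀ a, a ∈ F ↔ f (Additive.ofMul a) = 0 := fun a => Iff.rfl
  have hNA : NG A := NG.of_comm hAfg
  have hFfg : Group.FG F := (hNA.sub F).fg
  have hrank : Module.finrank ℤ (Additive F) < n := by
    have hfin : Module.Finite ℤ (Additive A) := Module.Finite.iff_addGroup_fg.2 inferInstance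
    let g : Additive A →ₗ[ℤ] ℂ := f.toIntLinearMap
    have h1 := Submodule.finrank_quotient_add_finrank (LinearMap.ker g)
    rw [g.quotKerEquivRange.finrank_eq] at h1
    have h2 : 0 < Module.finrank ℤ (LinearMap.range g) := by
      have : Nontrivial (LinearMap.range g) :=
        ⟨⟨⟨f (Additive.ofMul a0), Additive.ofMul a0, rfl⟩, 0, fun h => ha0 (congrArg Subtype.val h)⟩⟩
      exact Module.finrank_pos
    let e : Additive F ≃+ LinearMap.ker g :=
      { toFun := fun x => ⟨Additive.ofMul ((Additive.toMul x : F) : A), (Additive.toMul x).2⟩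
        invFun := fun x => Additive.ofMul ⟨Additive.toMul (x : Additive A), x.2⟩
        left_inv := fun _ => rfl
        right_inv := fun _ => rfl
        map_add' := fun _ _ => rfl }
    have h3 := e.toIntLinearEquiv.finrank_eq
    omega
  apply NG.of_finiteIndex Δ
  let φ1 : Δ →* MulAut A := φ.comp Δ.subtype
  have hk1 : NG φ1.ker := NG.ker_comp φ Δ hk
  have hinv : ∀ γ, ∀ a ∈ F, φ1 γ a ∈ F := by
    intro γ a ha
    rw [hF] at ha ⊢
    have := hχ γ a
    rw [ha, mul_zero] at this
    exact this
  refine ih F hrank Δ (resAut φ1 F hinv) ?_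
  set Δ1 := (resAut φ1 F hinv).ker with hΔ1
  have hk2 : NG (φ1.comp Δ1.subtype).ker := NG.ker_comp φ1 Δ1 hk1
  let M : AddSubgroup ℂ := f.range
  have hM : M.FG := by
    have : AddGroup.FG f.range := inferInstance
    exact (AddGroup.fg_iff_addSubgroup_fg _).1 this
  refine NG.of_char (χ.comp Δ1.subtype) M hM _ ⟨Additive.ofMul a0, rfl⟩ ha0 ?_ ?_
  · rintro γ _ ⟨x, rfl⟩
    exact ⟨Additive.ofMul (φ1 γ (Additive.toMul x)), hχ γ (Additive.toMul x)⟩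
  set Δ2 := (χ.comp Δ1.subtype).ker with hΔ2
  refine NG.stab ((φ1.comp Δ1.subtype).comp Δ2.subtype) F hAfg (hNA.sub F)
    (fun a _ b _ => mul_comm a b) ?_ ?_ (NG.ker_comp _ Δ2 hk2)
  · intro γ a ha
    have h1 : resAut φ1 F hinv ((γ : Δ1) : Δ) = 1 := (γ : Δ1).2
    exact congrArg Subtype.val (DFunLike.congr_fun h1 ⟨a, ha⟩)
  · intro γ a
    have h1 : χ ((γ : Δ1) : Δ) = 1 := γ.2
    have h2 : (χ (γ : Δ1) : ℂ) = 1 := congrArg Units.val h1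
    have h3 := hχ (γ : Δ1) a
    rw [h2, one_mul] at h3
    rw [hF, ofMul_mul, map_add, ofMul_inv, map_neg]
    change -f (Additive.ofMul a) + f (Additive.ofMul (φ ((γ : Δ1) : Δ) a)) = 0
    rw [h3]; ring
theorem NG.aut_ab' {A Γ : Type*} [Group A] [Group Γ] [Group.IsSolvable Γ]
    (hc : ∀ a b : A, a * b = b * a) (hA : Group.FG A) (φ : Γ →* MulAut A) (hk : NG φ.ker) :
    NG Γ := by
  let _ : CommGroup A := { ‹Group A› with mul_comm := hc }
  exact NG.aut_ab _ A (Nat.lt_succ_self _) Γ φ hk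

theorem NG.aut (d : ℕ) : ∀ (N : Type*) [Group N], derivedSeries N d = ⊥ → NG N →
    ∀ (Γ : Type*) [Group Γ] [Group.IsSolvable Γ] (φ : Γ →* MulAut N), NG φ.ker → NG Γ := by
  induction d with
  | zero =>
    intro N _ h _ Γ _ _ φ hk
    have h1 : ∀ n : N, n = 1 := fun n => by
      have : n ∈ derivedSeries N 0 := by simp
      rw [h] at this
      simpa using this
    refine hk.of_inj (f := (⟨⟨fun γ => ⟨γ, ?_⟩, rfl⟩, fun _ _ => rfl⟩ : Γ →* φ.ker)) ?_
    · rw [MonoidHom.mem_ker]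
      ext n
      rw [h1 (φ γ n), h1 ((1 : MulAut N) n)]
    · intro x y hxy
      exact congrArg (fun z : φ.ker => (z : Γ)) hxy
  | succ d ih =>
    intro N _ h hN Γ _ _ φ hk
    let A : Subgroup N := derivedSeries N d
    have hAn : A.Normal := derivedSeries_normal N d
    have hAc : ∀ a ∈ A, ∀ b ∈ A, a * b = b * a := by
      intro a ha b hb
      have h1 : ⁅A, A⁆ = ⊥ := h
      have := Subgroup.commutator_eq_bot_iff_le_centralizer.1 h1 ha
      exact (Subgroup.mem_centralizer_iff.1 this b hb).symm
    have hinv : ∀ γ, ∀ a ∈ A, φ γ a ∈ A := by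
      intro γ a ha
      exact map_derivedSeries_le_derivedSeries (φ γ).toMonoidHom d ⟨a, ha, rfl⟩
    have hNA := hN.sub A
    refine NG.aut_ab' (fun a b => Subtype.ext (hAc a a.2 b b.2)) hNA.fg (resAut φ A hinv) ?_
    set Δ := (resAut φ A hinv).ker
    have hk1 : NG (φ.comp Δ.subtype).ker := NG.ker_comp φ Δ hk
    have hinv1 : ∀ γ, ∀ a ∈ A, (φ.comp Δ.subtype) γ a ∈ A := fun γ a ha => hinv γ a ha
    have hq : derivedSeries (N ⧸ A) d = ⊥ := by
      rw [← map_derivedSeries_eq (QuotientGroup.mk'_surjective A) d]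
      rw [Subgroup.map_eq_bot_iff, QuotientGroup.ker_mk']
    refine ih (N ⧸ A) hq (hN.map _ (QuotientGroup.mk'_surjective A)) Δ
      (quoAut (φ.comp Δ.subtype) A hinv1) ?_
    set E := (quoAut (φ.comp Δ.subtype) A hinv1).ker
    refine NG.stab ((φ.comp Δ.subtype).comp E.subtype) A hN.fg hNA hAc ?_ ?_ (NG.ker_comp _ E hk1)
    · intro γ a ha
      have h1 : resAut φ A hinv ((γ : Δ) : Γ) = 1 := (γ : Δ).2
      exact congrArg Subtype.val (DFunLike.congr_fun h1 ⟨a, ha⟩)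
    · intro γ n
      have h1 : quoAut (φ.comp Δ.subtype) A hinv1 (γ : Δ) = 1 := γ.2
      have h2 : ((φ ((γ : Δ) : Γ) n : N) : N ⧸ A) = (n : N ⧸ A) := DFunLike.congr_fun h1 (n : N ⧸ A)
      exact QuotientGroup.eq.1 h2.symm

theorem exists_max_comm (C : Type*) [Group C] : ∃ A : Subgroup C,
    (∀ a ∈ A, ∀ b ∈ A, a * b = b * a) ∧ ∀ x, (∀ a ∈ A, x * a = a * x) → x ∈ A := by
  obtain ⟨A, hA⟩ := zorn_le₀ {A : Subgroup C | ∀ a ∈ A, ∀ b ∈ A, a * b = b * a} (by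
    intro c hc hchain
    rcases c.eq_empty_or_nonempty with rfl | hne
    · exact ⟨⊥, by simp, by simp⟩
    refine ⟨sSup c, ?_, fun K hK => le_sSup hK⟩
    intro a ha b hb
    rw [Subgroup.mem_sSup_of_directedOn hne hchain.directedOn] at ha hb
    obtain ⟨K, hK, haK⟩ := ha
    obtain ⟨L, hL, hbL⟩ := hb
    obtain ⟨M, hM, hKM, hLM⟩ := hchain.directedOn K hK L hL
    exact hc hM a (hKM haK) b (hLM hbL))
  have hAc := hA.prop
  refine ⟨A, hAc, fun x hx => ?_⟩
  have hcl : ∀ a ∈ Subgroup.closure (insert x (A : Set C)),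
      ∀ b ∈ Subgroup.closure (insert x (A : Set C)), a * b = b * a := by
    have := Subgroup.isMulCommutative_closure (k := insert x (A : Set C)) (by
      rintro a (rfl | ha) b (rfl | hb)
      · rfl
      · exact hx b hb
      · exact (hx a ha).symm
      · exact hAc a ha b hb)
    intro a ha b hb
    exact congrArg Subtype.val (this.is_comm.comm ⟨a, ha⟩ ⟨b, hb⟩)
  have hle : A ≤ Subgroup.closure (insert x (A : Set C)) := fun a ha =>
    Subgroup.subset_closure (Or.inr ha)
  exact hA.le_of_ge hcl hle (Subgroup.subset_closure (Or.inl rfl))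

theorem NG.of_commutator (Γ : Type*) [Group Γ] [hs : Group.IsSolvable Γ]
    (hab : ∀ A : Subgroup Γ, (∀ a ∈ A, ∀ b ∈ A, a * b = b * a) → A.FG)
    (N : Subgroup Γ) [hNn : N.Normal] (hN : NG N)
    (hcom : ∀ x y : Γ, x * y * x⁻¹ * y⁻¹ ∈ N) : NG Γ := by
  have hsN : Group.IsSolvable N := inferInstance
  obtain ⟨d, hd⟩ := (Group.isSolvable_def N).1 hsN
  refine NG.aut d N hd hN Γ (MulAut.conjNormal (H := N)) ?_
  set C := (MulAut.conjNormal (H := N)).ker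
  have hC : ∀ c ∈ C, ∀ n ∈ N, c * n = n * c := by
    intro c hc n hn
    have h1 : MulAut.conjNormal (H := N) c = 1 := hc
    have h2 := congrArg Subtype.val (DFunLike.congr_fun h1 ⟨n, hn⟩)
    rw [MulAut.conjNormal_apply] at h2
    simp only [MulAut.one_apply] at h2
    exact mul_inv_eq_iff_eq_mul.1 h2
  obtain ⟨A, hA, hAmax⟩ := exists_max_comm C
  have hAn : A.Normal := by
    constructor
    intro a ha c
    have h1 : c * a * c⁻¹ = (c * a * c⁻¹ * a⁻¹) * a := by group
    rw [h1]
    refine A.mul_mem (hAmax _ fun b hb => ?_) ha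
    apply Subtype.ext
    exact (hC b b.2 _ (hcom c a)).symm
  have hAfg : Group.FG A := by
    have h1 : (A.map C.subtype).FG := hab _ (by
      rintro _ ⟨a, ha, rfl⟩ _ ⟨b, hb, rfl⟩
      exact congrArg Subtype.val (hA a ha b hb))
    rw [← Group.fg_iff_subgroup_fg] at h1
    exact Group.fg_of_surjective (f := (A.equivMapOfInjective C.subtype
      C.subtype_injective).symm.toMonoidHom) (MulEquiv.surjective _)
  have hcA : ∀ a b : A, a * b = b * a := fun a b => Subtype.ext (hA a a.2 b b.2)
  refine NG.aut_ab' hcA hAfg (MulAut.conjNormal (H := A)) ((NG.of_comm' hcA hAfg).of_le ?_)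
  intro c hc
  refine hAmax c fun a ha => ?_
  have h1 : MulAut.conjNormal (H := A) c = 1 := hc
  have h2 := congrArg Subtype.val (DFunLike.congr_fun h1 ⟨a, ha⟩)
  rw [MulAut.conjNormal_apply] at h2
  simp only [MulAut.one_apply] at h2
  exact mul_inv_eq_iff_eq_mul.1 h2

theorem NG.of_solvable (Γ : Type*) [Group Γ] [hs : Group.IsSolvable Γ]
    (hab : ∀ A : Subgroup Γ, (∀ a ∈ A, ∀ b ∈ A, a * b = b * a) → A.FG) : NG Γ := by
  obtain ⟨d, hd⟩ := (Group.isSolvable_def Γ).1 hs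
  have key : ∀ i ≤ d, NG (derivedSeries Γ (d - i)) := by
    intro i
    induction i with
    | zero =>
      intro _
      rw [Nat.sub_zero, hd]
      exact NG.of_finite
    | succ i ih =>
      intro hi
      have h1 := ih (by omega)
      have h2 : d - i = (d - (i + 1)) + 1 := by omega
      rw [h2] at h1
      set j := d - (i + 1)
      have hnm := derivedSeries_normal Γ (j + 1)
      refine NG.of_commutator (derivedSeries Γ j) ?_
        ((derivedSeries Γ (j + 1)).subgroupOf (derivedSeries Γ j)) ?_ ?_
      · intro A hA
        have h3 := hab (A.map (derivedSeries Γ j).subtype) (by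
          rintro _ ⟨a, ha, rfl⟩ _ ⟨b, hb, rfl⟩
          exact congrArg Subtype.val (hA a ha b hb))
        rw [← Group.fg_iff_subgroup_fg] at h3 ⊢
        exact Group.fg_of_surjective (f := (A.equivMapOfInjective (derivedSeries Γ j).subtype
          (derivedSeries Γ j).subtype_injective).symm.toMonoidHom) (MulEquiv.surjective _)
      · exact h1.of_inj (Subgroup.subgroupOfEquivOfLe
          (derivedSeries_antitone Γ (Nat.le_succ j))).toMonoidHom (MulEquiv.injective _)
      · intro x y
        rw [Subgroup.mem_subgroupOf, derivedSeries_succ]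
        exact Subgroup.commutator_mem_commutator x.2 y.2
  have h1 := key d le_rfl
  rw [Nat.sub_self, derivedSeries_zero] at h1
  exact h1.of_inj (Subgroup.topEquiv (G := Γ)).symm.toMonoidHom (MulEquiv.injective _)

theorem nil_sSup {G : Type*} [Group G] (C : Set (Subgroup G)) (hne : C.Nonempty)
    (hdir : DirectedOn (· ≤ ·) C) (n : ℕ) :
    ∀ x ∈ (sSup C).lowerCentralSeries n, ∃ K ∈ C, x ∈ K.lowerCentralSeries n := by
  induction n with
  | zero =>
    intro x hx
    exact (Subgroup.mem_sSup_of_directedOn hne hdir).1 hx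
  | succ n ih =>
    intro x hx
    rw [Subgroup.lowerCentralSeries_succ] at hx
    induction hx using Subgroup.closure_induction with
    | mem x hx =>
      obtain ⟨a, ha, b, hb, rfl⟩ := hx
      obtain ⟨K, hK, haK⟩ := ih a ha
      obtain ⟨L, hL, hbL⟩ := (Subgroup.mem_sSup_of_directedOn hne hdir).1 hb
      obtain ⟨M, hM, hKM, hLM⟩ := hdir K hK L hL
      refine ⟨M, hM, ?_⟩
      exact Subgroup.commutator_mem_commutator (Subgroup.lowerCentralSeries_mono n hKM haK) (hLM hbL)
    | one =>
      obtain ⟨K, hK⟩ := hne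
      exact ⟨K, hK, one_mem _⟩
    | mul x y _ _ hx hy =>
      obtain ⟨K, hK, hxK⟩ := hx
      obtain ⟨L, hL, hyL⟩ := hy
      obtain ⟨M, hM, hKM, hLM⟩ := hdir K hK L hL
      exact ⟨M, hM, mul_mem (Subgroup.lowerCentralSeries_mono _ hKM hxK)
        (Subgroup.lowerCentralSeries_mono _ hLM hyL)⟩
    | inv x _ hx =>
      obtain ⟨K, hK, hxK⟩ := hx
      exact ⟨K, hK, inv_mem hxK⟩

theorem lcs_top_iff {G : Type*} [Group G] (K : Subgroup G) (n : ℕ) :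
    (⊤ : Subgroup K).lowerCentralSeries n = ⊥ ↔ K.lowerCentralSeries n = ⊥ := by
  rw [← Subgroup.top_subtype_lowerCentralSeries K n]
  rw [Subgroup.map_eq_bot_iff_of_injective _ K.subtype_injective]

theorem stmt_5 {G : Type*} [Group G] :
    List.TFAE [
      ∀ c : ℕ, 1 ≤ c → ∀ S : Set (Subgroup G), S.Nonempty →
        (∀ K ∈ S, Subgroup.lowerCentralSeries (⊤ : Subgroup K) c = ⊥) →
        ∃ M ∈ S, ∀ K ∈ S, M ≤ K → K = M,
      ∀ H : Subgroup G, IsSolvable H → H.FG,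
      ∀ A : Subgroup G, IsMulCommutative A → A.FG] := by
  tfae_have 1 → 3 := by
    intro h A hA
    have hAc : ∀ a ∈ A, ∀ b ∈ A, a * b = b * a := fun a ha b hb =>
      congrArg Subtype.val (hA.is_comm.comm ⟨a, ha⟩ ⟨b, hb⟩)
    obtain ⟨M, ⟨hMA, hMfg⟩, hmax⟩ := h 1 le_rfl {K | K ≤ A ∧ K.FG} ⟨⊥, bot_le, Subgroup.FG.bot⟩ (by
      rintro K ⟨hK, -⟩
      rw [lcs_top_iff, Subgroup.lowerCentralSeries_succ, Subgroup.lowerCentralSeries_zero,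
        Subgroup.commutator_eq_bot_iff_le_centralizer]
      intro x hx
      rw [Subgroup.mem_centralizer_iff]
      intro y hy
      exact hAc y (hK hy) x (hK hx))
    have : A = M := by
      refine le_antisymm (fun a ha => ?_) hMA
      have h1 := hmax (M ⊔ Subgroup.closure {a}) ⟨sup_le hMA (by simpa using ha),
        hMfg.sup ⟨{a}, by simp⟩⟩ le_sup_left
      rw [← h1]
      exact (le_sup_right : _ ≤ M ⊔ Subgroup.closure {a}) (Subgroup.subset_closure rfl)
    exact this ▸ hMfg
  tfae_have 3 → 2 := by
    intro h H hH
    have hH' : Group.IsSolvable H := hH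
    have h1 : NG H := NG.of_solvable H (by
      intro A hA
      have h3 := h (A.map H.subtype) ⟨⟨by
        rintro ⟨_, a, ha, rfl⟩ ⟨_, b, hb, rfl⟩
        exact Subtype.ext (congrArg (fun z : H => (z : G)) (hA a ha b hb))⟩⟩
      rw [← Group.fg_iff_subgroup_fg] at h3 ⊢
      exact Group.fg_of_surjective (f := (A.equivMapOfInjective H.subtype
          H.subtype_injective).symm.toMonoidHom) (MulEquiv.surjective _))
    exact (Group.fg_iff_subgroup_fg H).1 h1.fg
  tfae_have 2 → 1 := by
    intro h c _ S hS hSn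
    obtain ⟨K0, hK0⟩ := hS
    obtain ⟨M, -, hM⟩ := zorn_le_nonempty₀ S (by
      intro C hCS hchain K hK
      have hne : C.Nonempty := ⟨K, hK⟩
      have hdir := hchain.directedOn
      have hlcs : (sSup C).lowerCentralSeries c = ⊥ := by
        rw [eq_bot_iff]
        intro x hx
        obtain ⟨L, hL, hxL⟩ := nil_sSup C hne hdir c x hx
        rwa [(lcs_top_iff L c).1 (hSn L (hCS hL))] at hxL
      have hnil : Group.IsNilpotent (sSup C : Subgroup G) :=
        Subgroup.isNilpotent_of_lowerCentralSeries_eq_bot hlcs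
      have hsol : Group.IsSolvable (sSup C : Subgroup G) := inferInstance
      obtain ⟨T, hT⟩ := h (sSup C) hsol
      have hT2 : ∃ L ∈ C, (T : Set G) ⊆ L := by
        have hT1 : ∀ t ∈ T, t ∈ sSup C := fun t ht => hT ▸ Subgroup.subset_closure ht
        clear hT
        classical
        induction T using Finset.induction_on with
        | empty => exact ⟨K, hK, by simp⟩
        | insert t T _ ih =>
          obtain ⟨L, hL, hTL⟩ := ih fun s hs => hT1 s (Finset.mem_insert_of_mem hs)
          obtain ⟨L', hL', ht⟩ := (Subgroup.mem_sSup_of_directedOn hne hdir).1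
            (hT1 t (Finset.mem_insert_self t T))
          obtain ⟨M, hM, h1, h2⟩ := hdir L hL L' hL'
          refine ⟨M, hM, ?_⟩
          rw [Finset.coe_insert, Set.insert_subset_iff]
          exact ⟨h2 ht, hTL.trans h1⟩
      obtain ⟨L, hL, hTL⟩ := hT2
      refine ⟨L, hCS hL, fun z hz => (le_sSup hz).trans ?_⟩
      rw [← hT]
      exact (Subgroup.closure_le L).2 hTL) K0 hK0
    exact ⟨M, hM.prop, fun K hK hMK => le_antisymm (hM.le_of_ge hK hMK) hMK⟩
  tfae_finish
end

section
/- Let G be a finitely generated group containing a finite normal subgroup N such that the quotient G/N is abelian. Then G is virtually abelian, i.e., G contains an abelian subgroup of finite index. -/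
/-- A finitely generated group containing a finite normal subgroup with abelian
quotient is virtually abelian: it contains an abelian subgroup of finite index. -/
theorem stmt_8 {G : Type*} [Group G] [Group.FG G] (N : Subgroup G) [N.Normal]
    (hfin : Finite N) (hab : ∀ x y : G ⧸ N, x * y = y * x) :
    ∃ A : Subgroup G, IsMulCommutative A ∧ A.FiniteIndex := by
  have hsub : commutatorSet G ⊆ (N : Set G) := by
    rintro _ ⟨a, b, rfl⟩
    have h := hab (a : G ⧸ N) (b : G ⧸ N)
    have h2 : ((a * b * a⁻¹ * b⁻¹ : G) : G ⧸ N) = 1 := by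
      change (a : G ⧸ N) * (b : G ⧸ N) * (a : G ⧸ N)⁻¹ * (b : G ⧸ N)⁻¹ = 1
      rw [h]
      group
    exact (QuotientGroup.eq_one_iff _).1 h2
  have : Finite (commutatorSet G) := (Set.toFinite (N : Set G)).subset hsub
  exact ⟨Subgroup.center G, inferInstance, inferInstance⟩
end

section
/- Let G be a finitely generated nilpotent group that is not virtually abelian. Then the quotient G/γ₃(G) is not virtually abelian. -/
open scoped commutatorElement

lemma aux_finite_closure {Q : Type*} [Group Q] (U : Set Q) (hU : U.Finite)
    (hc : U ⊆ Subgroup.center Q) (ht : ∀ u ∈ U, IsOfFinOrder u) :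
    Finite (Subgroup.closure U) := by
  have hD : Subgroup.closure U ≤ Subgroup.center Q := (Subgroup.closure_le _).2 hc
  letI : CommGroup (Subgroup.closure U) :=
    { (inferInstance : Group (Subgroup.closure U)) with
      mul_comm := fun a b => Subtype.ext ((Subgroup.mem_center_iff.1 (hD b.2)) a) }
  haveI : Group.FG (Subgroup.closure U) :=
    (Group.fg_iff_subgroup_fg _).2 ⟨hU.toFinset, by simp⟩
  have htor : ∀ x ∈ Subgroup.closure U, IsOfFinOrder x := by
    intro x hx
    induction hx using Subgroup.closure_induction with
    | mem x hx => exact ht x hx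
    | one => exact IsOfFinOrder.one
    | mul x y hx hy h1 h2 =>
      exact Commute.isOfFinOrder_mul (Subgroup.mem_center_iff.1 (hD hy) x) h1 h2
    | inv x hx h => exact h.inv
  exact CommGroup.finite_of_fg_torsion _ fun x => by
    rw [← Submonoid.isOfFinOrder_coe]
    exact htor x x.2

lemma aux_comm_pow {Q : Type*} [Group Q] (t s : Q) (h : ⁅t, s⁆ ∈ Subgroup.center Q) (n : ℕ) :
    ⁅t ^ n, s⁆ = ⁅t, s⁆ ^ n := by
  induction n with
  | zero => simp
  | succ n ih =>
    rw [pow_succ, commutatorElement_mul_left_eq_conj_mul, ih, pow_succ']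
    congr 1
    rw [Subgroup.mem_center_iff.1 h, mul_inv_cancel_right]

lemma aux_key {Q : Type*} [Group Q] (A : Subgroup Q) (T S : Set Q) (hT : T.Finite) (hS : S.Finite)
    (hS1 : Subgroup.closure S = ⊤) (hc : ∀ t ∈ T, ∀ s ∈ S, ⁅t, s⁆ ∈ Subgroup.center Q)
    (ho : ∀ t ∈ T, ∀ s ∈ S, IsOfFinOrder ⁅t, s⁆)
    (hA : A ≤ Subgroup.closure T ⊔ Subgroup.center Q) : Finite (⁅A, ⊤⁆ : Subgroup Q) := by
  set U : Set Q := Set.image2 (fun t s => ⁅t, s⁆) T S with hUdef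
  have hUc : U ⊆ Subgroup.center Q := by
    rintro _ ⟨t, ht, s, hs, rfl⟩; exact hc t ht s hs
  have hfin := aux_finite_closure U (hT.image2 _ hS) hUc (by
    rintro _ ⟨t, ht, s, hs, rfl⟩; exact ho t ht s hs)
  have hD : Subgroup.closure U ≤ Subgroup.center Q := (Subgroup.closure_le _).2 hUc
  have hconj : ∀ d ∈ Subgroup.closure U, ∀ a : Q, a * d * a⁻¹ = d := fun d hd a => by
    rw [Subgroup.mem_center_iff.1 (hD hd) a, mul_inv_cancel_right]
  have hconj' : ∀ d ∈ Subgroup.closure U, ∀ a : Q, a⁻¹ * d * a = d := fun d hd a => by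
    simpa using hconj d hd a⁻¹
  have h1 : ∀ t ∈ T, ∀ g : Q, ⁅t, g⁆ ∈ Subgroup.closure U := by
    intro t ht g
    have hg : g ∈ Subgroup.closure S := hS1 ▸ Subgroup.mem_top g
    induction hg using Subgroup.closure_induction with
    | mem x hx => exact Subgroup.subset_closure ⟨t, ht, x, hx, rfl⟩
    | one => simp
    | mul x y _ _ hx hy =>
      rw [commutatorElement_mul_right_eq_mul_conj]
      have h2 := mul_mem hx hy
      rw [← hconj _ hy x] at h2
      simpa only [mul_assoc] using h2
    | inv x _ hx =>
      rw [commutatorElement_inv_right, ← commutatorElement_inv, hconj' _ (inv_mem hx)]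
      exact inv_mem hx
  let E : Subgroup Q :=
    { carrier := {a | ∀ g, ⁅a, g⁆ ∈ Subgroup.closure U}
      one_mem' := fun g => by simp
      mul_mem' := fun {a b} ha hb g => by
        rw [commutatorElement_mul_left_eq_conj_mul]
        simp only [hconj _ (hb g)]
        exact mul_mem (hb g) (ha g)
      inv_mem' := fun {a} ha g => by
        rw [commutatorElement_inv_left, ← commutatorElement_inv, hconj' _ (inv_mem (ha g))]
        exact inv_mem (ha g) }
  have hE : A ≤ E := hA.trans (sup_le ((Subgroup.closure_le _).2 fun t ht => h1 t ht)
    fun z hz g => by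
      rw [commutatorElement_eq_one_iff_mul_comm.2 (Subgroup.mem_center_iff.1 hz g).symm]
      exact one_mem _)
  have hle : ⁅A, ⊤⁆ ≤ Subgroup.closure U :=
    Subgroup.commutator_le.2 fun a ha g _ => hE ha g
  exact Finite.of_injective _ (Subgroup.inclusion_injective hle)

lemma aux_center {G : Type*} [Group G] (n : ℕ) :
    ((⊤ : Subgroup G).lowerCentralSeries n).map
      (QuotientGroup.mk' ((⊤ : Subgroup G).lowerCentralSeries (n+1))) ≤ Subgroup.center _ := by
  rw [← Subgroup.commutator_top_right_eq_bot_iff_le_center,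
    ← Subgroup.map_top_of_surjective _ (QuotientGroup.mk'_surjective _),
    ← Subgroup.map_commutator, ← Subgroup.lowerCentralSeries_succ, Subgroup.map_eq_bot_iff,
    QuotientGroup.ker_mk']

lemma aux_map_succ {G : Type*} [Group G] {Q : Type*} [Group Q] (f : G →* Q)
    (hf : Function.Surjective f) (n : ℕ) :
    ((⊤ : Subgroup G).lowerCentralSeries (n+1)).map f =
      ⁅((⊤ : Subgroup G).lowerCentralSeries n).map f, ⊤⁆ := by
  rw [Subgroup.lowerCentralSeries_succ, Subgroup.map_commutator,
    Subgroup.map_top_of_surjective _ hf]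

lemma aux_gen {Q : Type*} [Group Q] [Group.FG Q] :
    ∃ S : Set Q, S.Finite ∧ Subgroup.closure S = ⊤ := by
  obtain ⟨S, hS⟩ := Group.fg_def.1 (inferInstance : Group.FG Q)
  exact ⟨S, S.finite_toSet, hS⟩

lemma aux_base {G : Type*} [Group G] [Group.FG G]
    (B : Subgroup (G ⧸ (⊤ : Subgroup G).lowerCentralSeries 2)) (hB : IsMulCommutative B)
    (hi : B.FiniteIndex) :
    ((⊤ : Subgroup G).lowerCentralSeries 2).relIndex ((⊤ : Subgroup G).lowerCentralSeries 1) ≠ 0 := by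
  set f := QuotientGroup.mk' ((⊤ : Subgroup G).lowerCentralSeries 2) with hf
  have hfs : Function.Surjective f := QuotientGroup.mk'_surjective _
  have hcen := aux_center (G := G) 1
  obtain ⟨S, hSf, hS⟩ := aux_gen (Q := G ⧸ (⊤ : Subgroup G).lowerCentralSeries 2)
  have hcomm : ∀ x y : G ⧸ (⊤ : Subgroup G).lowerCentralSeries 2,
      ⁅x, y⁆ ∈ Subgroup.center (G ⧸ (⊤ : Subgroup G).lowerCentralSeries 2) := by
    intro x y
    apply hcen
    rw [aux_map_succ _ hfs]
    refine Subgroup.commutator_mem_commutator ?_ (Subgroup.mem_top _)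
    rw [Subgroup.lowerCentralSeries_zero, Subgroup.map_top_of_surjective _ hfs]
    trivial
  have key := aux_key (⊤ : Subgroup (G ⧸ (⊤ : Subgroup G).lowerCentralSeries 2)) S S hSf hSf hS
    (fun t _ s _ => hcomm t s) (fun t _ s _ => by
      obtain ⟨a, ha, -, hta⟩ := Subgroup.exists_pow_mem_of_index_ne_zero hi.index_ne_zero t
      obtain ⟨b, hb, -, hsb⟩ := Subgroup.exists_pow_mem_of_index_ne_zero hi.index_ne_zero s
      have h0 : ⁅t ^ a, s ^ b⁆ = 1 := by
        rw [commutatorElement_eq_one_iff_mul_comm]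
        exact congrArg Subtype.val (hB.is_comm.comm (⟨_, hta⟩ : B) ⟨_, hsb⟩)
      rw [aux_comm_pow _ _ (hcomm _ _), ← commutatorElement_inv, aux_comm_pow _ _ (hcomm _ _),
        ← inv_pow, commutatorElement_inv, ← pow_mul] at h0
      exact isOfFinOrder_iff_pow_eq_one.2 ⟨b * a, by positivity, h0⟩)
    (by rw [hS]; exact le_sup_left)
  have hk : f.ker = (⊤ : Subgroup G).lowerCentralSeries 2 := QuotientGroup.ker_mk' _
  rw [← hk, Subgroup.relIndex_ker, aux_map_succ _ hfs, Subgroup.lowerCentralSeries_zero,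
    Subgroup.map_top_of_surjective _ hfs]
  exact Nat.card_pos.ne'

lemma aux_step {G : Type*} [Group G] [Group.FG G] (n : ℕ)
    (h : ((⊤ : Subgroup G).lowerCentralSeries (n+1)).relIndex
      ((⊤ : Subgroup G).lowerCentralSeries n) ≠ 0) :
    ((⊤ : Subgroup G).lowerCentralSeries (n+2)).relIndex
      ((⊤ : Subgroup G).lowerCentralSeries (n+1)) ≠ 0 := by
  set f := QuotientGroup.mk' ((⊤ : Subgroup G).lowerCentralSeries (n+2)) with hf
  set p := QuotientGroup.mk' ((⊤ : Subgroup G).lowerCentralSeries (n+1)) with hp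
  have hfs : Function.Surjective f := QuotientGroup.mk'_surjective _
  have hk : f.ker = (⊤ : Subgroup G).lowerCentralSeries (n+2) := QuotientGroup.ker_mk' _
  have hkp : p.ker = (⊤ : Subgroup G).lowerCentralSeries (n+1) := QuotientGroup.ker_mk' _
  have hcen := aux_center (G := G) (n+1)
  obtain ⟨S, hSf, hS⟩ := aux_gen (Q := G ⧸ (⊤ : Subgroup G).lowerCentralSeries (n+2))
  have hfin : (p '' ((⊤ : Subgroup G).lowerCentralSeries n)).Finite := by
    rw [← hkp, Subgroup.relIndex_ker] at h
    exact Nat.finite_of_card_ne_zero h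
  obtain ⟨T, hTs, hT⟩ := Set.SurjOn.exists_bijOn_subset
    (Set.surjOn_image p ((⊤ : Subgroup G).lowerCentralSeries n : Set G))
  have hTf : T.Finite := (Set.BijOn.finite_iff_finite hT).2 hfin
  have hcomm : ∀ x ∈ (⊤ : Subgroup G).lowerCentralSeries n, ∀ y,
      ⁅f x, y⁆ ∈ Subgroup.center (G ⧸ (⊤ : Subgroup G).lowerCentralSeries (n+2)) := by
    intro x hx y
    apply hcen
    rw [aux_map_succ _ hfs]
    exact Subgroup.commutator_mem_commutator (Subgroup.mem_map_of_mem _ hx) (Subgroup.mem_top _)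
  have key := aux_key (((⊤ : Subgroup G).lowerCentralSeries n).map f) (f '' T) S (hTf.image _) hSf hS
    (by rintro _ ⟨t, ht, rfl⟩ s _; exact hcomm t (hTs ht) s)
    (by
      rintro _ ⟨t, ht, rfl⟩ s _
      obtain ⟨a, ha, -, hta⟩ := Subgroup.exists_pow_mem_of_relIndex_ne_zero h (hTs ht)
      refine isOfFinOrder_iff_pow_eq_one.2 ⟨a, ha, ?_⟩
      rw [← aux_comm_pow _ _ (hcomm t (hTs ht) s), ← map_pow, commutatorElement_eq_one_iff_mul_comm]
      exact (Subgroup.mem_center_iff.1 (hcen (Subgroup.mem_map_of_mem f hta.1)) s).symm)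
    (by
      rintro _ ⟨x, hx, rfl⟩
      obtain ⟨t, ht, htx⟩ := hT.surjOn ⟨x, hx, rfl⟩
      have h1 : t⁻¹ * x ∈ (⊤ : Subgroup G).lowerCentralSeries (n+1) := by
        rw [← hkp, MonoidHom.mem_ker, map_mul, map_inv, htx, inv_mul_cancel]
      have h2 : f x = f t * f (t⁻¹ * x) := by rw [← map_mul, mul_inv_cancel_left]
      rw [h2]
      exact Subgroup.mul_mem_sup (Subgroup.subset_closure ⟨t, ht, rfl⟩)
        (hcen (Subgroup.mem_map_of_mem f h1)))
  rw [← hk, Subgroup.relIndex_ker, aux_map_succ _ hfs]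
  exact Nat.card_pos.ne'

/-- If `G` is a finitely generated nilpotent group that is not virtually abelian, then
`G/γ₃(G)` is not virtually abelian. Here `γ₃(G) = lowerCentralSeries G 2 = [[G,G],G]`,
and "virtually abelian" means containing an abelian subgroup of finite index. -/
theorem stmt_10 {G : Type*} [Group G] [Group.FG G] [Group.IsNilpotent G]
    (h : ¬ ∃ A : Subgroup G, IsMulCommutative A ∧ A.FiniteIndex) :
    ¬ ∃ B : Subgroup (G ⧸ (⊤ : Subgroup G).lowerCentralSeries 2), IsMulCommutative B ∧ B.FiniteIndex := by
  rintro ⟨B, hB, hi⟩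
  apply h
  have h1 : ∀ n : ℕ, ((⊤ : Subgroup G).lowerCentralSeries (n+2)).relIndex
      ((⊤ : Subgroup G).lowerCentralSeries (n+1)) ≠ 0 := by
    intro n
    induction n with
    | zero => exact aux_base B hB hi
    | succ n ih => exact aux_step (n+1) ih
  have h2 : ∀ n : ℕ, ((⊤ : Subgroup G).lowerCentralSeries (n+1)).relIndex
      ((⊤ : Subgroup G).lowerCentralSeries 1) ≠ 0 := by
    intro n
    induction n with
    | zero => simp
    | succ n ih => exact Subgroup.relIndex_ne_zero_trans (h1 n) ih
  obtain ⟨c, hc⟩ := Subgroup.nilpotent_iff_lowerCentralSeries.1 (inferInstance : Group.IsNilpotent G)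
  have h3 : (⊤ : Subgroup G).lowerCentralSeries (c+1) = ⊥ :=
    le_bot_iff.1 (hc ▸ Subgroup.lowerCentralSeries_antitone _ (Nat.le_succ c))
  have h4 := h2 c
  rw [h3, Subgroup.relIndex_bot_left, Subgroup.top_lowerCentralSeries_one] at h4
  have h5 : Finite (commutator G) := Nat.finite_of_card_ne_zero h4
  have h6 : Finite (commutatorSet G) := by
    have : commutatorSet G ⊆ (commutator G : Set G) := by
      rw [commutator_eq_closure]; exact Subgroup.subset_closure
    exact Set.Finite.subset (s := (commutator G : Set G)) h5 this
  exact ⟨Subgroup.center G, inferInstance, inferInstance⟩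
end

section
/- Let (Hᵢ)_{i∈ι} be a family of groups such that for every i every abelian subgroup of Hᵢ is finitely generated. Then every abelian subgroup of the free product ∗ᵢ Hᵢ is finitely generated. -/
namespace FreeProdAb

open Monoid

variable {ι : Type*} {H : ι → Type*} [∀ i, Group (H i)]

/-- Reduced lists of letters. -/
def Red (L : List (Σ i, H i)) : Prop :=
  (∀ l ∈ L, l.2 ≠ 1) ∧ L.IsChain (fun l l' => l.1 ≠ l'.1)

/-- The element of the free product given by a list. -/
def P (L : List (Σ i, H i)) : CoprodI H :=
  (L.map fun l => (CoprodI.of l.2 : CoprodI H)).prod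

theorem P_nil : P ([] : List (Σ i, H i)) = 1 := rfl

theorem P_single (l : Σ i, H i) : P [l] = CoprodI.of l.2 := by simp [P]

theorem P_append (L L' : List (Σ i, H i)) : P (L ++ L') = P L * P L' := by simp [P]

theorem P_cons (l : Σ i, H i) (L : List (Σ i, H i)) : P (l :: L) = CoprodI.of l.2 * P L := by
  simp [P]

theorem exists_red (g : CoprodI H) : ∃ L : List (Σ i, H i), Red L ∧ P L = g := by
  classical
  refine ⟨(CoprodI.Word.equiv g).toList, ⟨?_, (CoprodI.Word.equiv g).chain_ne⟩,
    CoprodI.Word.equiv.left_inv g⟩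
  rintro l hl
  exact (CoprodI.Word.equiv g).ne_one l hl

theorem red_unique {L L' : List (Σ i, H i)} (h : Red L) (h' : Red L') (e : P L = P L') :
    L = L' := by
  classical
  let w : CoprodI.Word H := ⟨L, fun l hl => h.1 l hl, h.2⟩
  let w' : CoprodI.Word H := ⟨L', fun l hl => h'.1 l hl, h'.2⟩
  have : w = w' := CoprodI.Word.equiv.symm.injective e
  exact congrArg CoprodI.Word.toList this

theorem red_append {L L' : List (Σ i, H i)} : Red (L ++ L') ↔
    Red L ∧ Red L' ∧ ∀ x ∈ L.getLast?, ∀ y ∈ L'.head?, x.1 ≠ y.1 := by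
  simp only [Red, List.mem_append, List.isChain_append]
  grind

theorem red_single {i : ι} {m : H i} (hm : m ≠ 1) : Red [(⟨i, m⟩ : Σ i, H i)] := by
  simp [Red, hm]

/-- Inverse list. -/
def I (L : List (Σ i, H i)) : List (Σ i, H i) := (L.map fun l => ⟨l.1, l.2⁻¹⟩).reverse

theorem P_I (L : List (Σ i, H i)) : P (I L) = (P L)⁻¹ := by
  induction L with
  | nil => simp [P, I]
  | cons l L ih =>
    have : I (l :: L) = I L ++ [⟨l.1, l.2⁻¹⟩] := by simp [I]
    rw [this, P_append, ih, P_single, P_cons]; simp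

theorem red_I {L : List (Σ i, H i)} (h : Red L) : Red (I L) := by
  constructor
  · intro l hl
    simp only [I, List.mem_reverse, List.mem_map] at hl
    obtain ⟨x, hx, rfl⟩ := hl
    simpa using h.1 x hx
  · simp only [I, List.isChain_reverse, List.isChain_map]
    exact h.2.imp fun a b hab => hab.symm

theorem length_I (L : List (Σ i, H i)) : (I L).length = L.length := by simp [I]

theorem conj_lemma {i : ι} (n : ℕ) : ∀ (L : List (Σ i, H i)), L.length = n → Red L →
    ∀ h h' : H i, h ≠ 1 → P L * CoprodI.of h = CoprodI.of h' * P L →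
    P L ∈ (CoprodI.of : H i →* CoprodI H).range := by
  induction n using Nat.strong_induction_on with
  | _ n ih =>
  intro L hn hL h h' hh e
  rcases L.eq_nil_or_concat with rfl | ⟨L', ⟨j, m⟩, rfl⟩
  · exact one_mem _
  rw [List.concat_eq_append] at *
  by_cases hj : j = i
  · subst hj
    have := ih L'.length (by simp at hn; omega) L' rfl (red_append.1 hL).1 (m * h * m⁻¹) h'
      (by simpa using hh) (by
        rw [P_append, P_single] at e
        simp only [map_mul, map_inv]
        simp only [← mul_assoc] at e ⊢
        rw [e]; simp [mul_assoc])
    rw [P_append, P_single]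
    exact mul_mem this ⟨m, rfl⟩
  have r1 : Red ((L' ++ [⟨j, m⟩]) ++ [(⟨i, h⟩ : Σ i, H i)]) :=
    red_append.2 ⟨hL, red_single hh, by simpa using hj⟩
  have p1 : P ((L' ++ [⟨j, m⟩]) ++ [(⟨i, h⟩ : Σ i, H i)]) =
    CoprodI.of h' * P (L' ++ [⟨j, m⟩]) := by
    rw [P_append _ [_], P_single, e]
  generalize L' ++ [⟨j, m⟩] = L at *
  have h1 : h' ≠ 1 := by
    rintro rfl
    have := red_unique r1 hL (by rw [p1]; simp)
    simpa using congrArg List.length this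
  rcases L with _ | ⟨⟨k, m'⟩, L⟩
  · exact one_mem _
  by_cases hk : k = i
  · subst hk
    have := ih L.length (by simp at hn; omega) L rfl (red_append (L := [⟨k, m'⟩]).1 hL).2.1 h
      (m'⁻¹ * h' * m') hh (by
        rw [P_cons] at e
        simp only [map_mul, map_inv]
        simp only [mul_assoc] at e ⊢
        rw [← e]; simp)
    rw [P_cons]
    exact mul_mem ⟨m', rfl⟩ this
  have r2 : Red ([(⟨i, h'⟩ : Σ i, H i)] ++ (⟨k, m'⟩ :: L)) :=
    red_append.2 ⟨red_single h1, hL, by simpa using Ne.symm hk⟩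
  have := red_unique r1 r2 (by rw [p1, P_append, P_single])
  simp at this
  exact absurd this.1.1 hk

theorem I_head {L : List (Σ i, H i)} {y} (hy : y ∈ (I L).head?) :
    ∃ z ∈ L.getLast?, z.1 = y.1 := by
  simp only [I, List.head?_reverse, List.getLast?_map] at hy
  simp only [Option.mem_def, Option.map_eq_some_iff] at hy
  obtain ⟨z, hz, rfl⟩ := hy
  exact ⟨z, hz, rfl⟩

theorem I_last {L : List (Σ i, H i)} {y} (hy : y ∈ (I L).getLast?) :
    ∃ z ∈ L.head?, z.1 = y.1 := by
  simp only [I, List.getLast?_reverse, List.head?_map] at hy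
  simp only [Option.mem_def, Option.map_eq_some_iff] at hy
  obtain ⟨z, hz, rfl⟩ := hy
  exact ⟨z, hz, rfl⟩

theorem prefix_step {a x : List (Σ i, H i)} (h1 : Red (a ++ x)) (h2 : Red (x ++ a))
    (e : P a * P x = P x * P a) (hl : a.length ≤ x.length) :
    ∃ y, Red y ∧ x = a ++ y := by
  have := red_unique h1 h2 (by rw [P_append, P_append, e])
  have hp : a <+: x := List.prefix_of_prefix_length_le (l₃ := a ++ x) ⟨x, rfl⟩ ⟨a, this.symm⟩ hl
  obtain ⟨y, rfl⟩ := hp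
  exact ⟨y, (red_append.1 (red_append.1 h1).2.1).2.1, rfl⟩

theorem head_append {L L' : List (Σ i, H i)} (h : L ≠ []) : (L ++ L').head? = L.head? := by
  cases L <;> simp_all

/-- Main reduction step. -/
theorem step {a x : List (Σ i, H i)} (ha : Red a) (hx : Red x) (ha0 : a ≠ [])
    (hcyc : ∀ u ∈ a.getLast?, ∀ v ∈ a.head?, u.1 ≠ v.1)
    (e : P a * P x = P x * P a) (hl : a.length ≤ x.length) :
    ∃ y, Red y ∧ y.length < x.length ∧ (P x = P a * P y ∨ P x = (P a)⁻¹ * P y) := by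
  have hpos : 0 < a.length := List.length_pos_of_ne_nil ha0
  have hx0 : x ≠ [] := by rintro rfl; simp at hl; exact ha0 hl
  have hIa0 : I a ≠ [] := by intro h; rw [← length_I, h] at hpos; simp at hpos
  have e' : P (I a) * P x = P x * P (I a) := by
    rw [P_I]; exact (Commute.inv_left (show Commute (P a) (P x) from e)).eq
  obtain ⟨ah, hah⟩ : ∃ t, a.head? = some t := ⟨_, List.head?_eq_some_head ha0⟩
  obtain ⟨al, hal⟩ : ∃ t, a.getLast? = some t := ⟨_, List.getLast?_eq_some_getLast ha0⟩
  obtain ⟨xh, hxh⟩ : ∃ t, x.head? = some t := ⟨_, List.head?_eq_some_head hx0⟩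
  obtain ⟨xl, hxl⟩ : ∃ t, x.getLast? = some t := ⟨_, List.getLast?_eq_some_getLast hx0⟩
  have hc : al.1 ≠ ah.1 := hcyc _ hal _ hah
  have A1 : al.1 ≠ xh.1 → Red (a ++ x) := fun h => red_append.2 ⟨ha, hx, by
    intro u hu v hv; simp_all⟩
  have A2 : xl.1 ≠ ah.1 → Red (x ++ a) := fun h => red_append.2 ⟨hx, ha, by
    intro u hu v hv; simp_all⟩
  have A3 : ah.1 ≠ xh.1 → Red (I a ++ x) := fun h => red_append.2 ⟨red_I ha, hx, by
    intro u hu v hv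
    obtain ⟨z, hz, hzu⟩ := I_last hu
    rw [← hzu]; simp_all⟩
  have A4 : xl.1 ≠ al.1 → Red (x ++ I a) := fun h => red_append.2 ⟨hx, red_I ha, by
    intro u hu v hv
    obtain ⟨z, hz, hzu⟩ := I_head hv
    rw [← hzu]; simp_all⟩
  by_cases c1 : xl.1 = ah.1 <;> by_cases c2 : xh.1 = al.1
  · have c3 : xl.1 ≠ al.1 := by rw [c1]; exact hc.symm
    have c4 : ah.1 ≠ xh.1 := by rw [c2]; exact hc.symm
    obtain ⟨y, hy, rfl⟩ := prefix_step (A3 c4) (A4 c3) e' (by rwa [length_I])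
    exact ⟨y, hy, by simp [length_I, hpos], Or.inr (by rw [P_append, P_I])⟩
  · exfalso
    have c3 : xl.1 ≠ al.1 := by rw [c1]; exact hc.symm
    have r : Red (a ++ (x ++ I a)) := red_append.2 ⟨ha, A4 c3, by
      rw [head_append hx0]; intro u hu v hv; simp_all; exact fun h => c2 h.symm⟩
    have := red_unique r hx (by rw [P_append, P_append, ← e', P_I]; simp)
    have := congrArg List.length this
    simp [length_I] at this; omega
  · exfalso
    have c4 : ah.1 ≠ xh.1 := by rw [c2]; exact hc.symm
    have r : Red (I a ++ (x ++ a)) := red_append.2 ⟨red_I ha, A2 c1, by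
      rw [head_append hx0]; exact (red_append.1 (A3 c4)).2.2⟩
    have := red_unique r hx (by rw [P_append, P_append, ← e, P_I]; simp)
    have := congrArg List.length this
    simp [length_I] at this; omega
  · obtain ⟨y, hy, rfl⟩ := prefix_step (A1 (Ne.symm c2)) (A2 c1) e hl
    exact ⟨y, hy, by simp [hpos], Or.inl (by rw [P_append])⟩

theorem cyclic_case {A : Subgroup (CoprodI H)} {a : List (Σ i, H i)} (ha : Red a) (ha0 : a ≠ [])
    (hcyc : ∀ u ∈ a.getLast?, ∀ v ∈ a.head?, u.1 ≠ v.1) (haA : P a ∈ A)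
    (hcomm : ∀ x ∈ A, P a * x = x * P a)
    (hmin : ∀ L : List (Σ i, H i), Red L → L ≠ [] → P L ∈ A → a.length ≤ L.length) :
    A = Subgroup.zpowers (P a) := by
  refine le_antisymm ?_ (by simpa using haA)
  have key : ∀ n : ℕ, ∀ x : List (Σ i, H i), x.length = n → Red x → P x ∈ A →
      P x ∈ Subgroup.zpowers (P a) := by
    intro n
    induction n using Nat.strong_induction_on with
    | _ n ih =>
    intro x hn hx hxA
    by_cases hx0 : x = []
    · subst hx0; exact one_mem _
    obtain ⟨y, hy, hlt, h | h⟩ := step ha hx ha0 hcyc (hcomm _ hxA) (hmin x hx hx0 hxA)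
    · have hyA : P y ∈ A := by rw [h] at hxA; exact (A.mul_mem_cancel_left haA).1 hxA
      rw [h]
      exact mul_mem (Subgroup.mem_zpowers _) (ih _ (hn ▸ hlt) y rfl hy hyA)
    · have hyA : P y ∈ A := by
        rw [h] at hxA; exact (A.mul_mem_cancel_left (inv_mem haA)).1 hxA
      rw [h]
      exact mul_mem (inv_mem (Subgroup.mem_zpowers _)) (ih _ (hn ▸ hlt) y rfl hy hyA)
  intro g hg
  obtain ⟨L, hL, rfl⟩ := exists_red g
  exact key _ L rfl hL hg

theorem fg_map {G K : Type*} [Group G] [Group K] (f : G →* K) {B : Subgroup G} (hB : B.FG) :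
    (B.map f).FG := by
  classical
  obtain ⟨S, rfl⟩ := hB
  exact ⟨S.image f, by rw [MonoidHom.map_closure, Finset.coe_image]⟩

theorem factor_case (h : ∀ i, ∀ A : Subgroup (H i), IsMulCommutative A → A.FG)
    {A : Subgroup (CoprodI H)} (hA : ∀ x ∈ A, ∀ y ∈ A, x * y = y * x) {i : ι}
    {m : H i} (hm : m ≠ 1) (hmA : CoprodI.of m ∈ A) : A.FG := by
  have hle : A ≤ (CoprodI.of : H i →* CoprodI H).range := by
    intro g hg
    obtain ⟨L, hL, rfl⟩ := exists_red g
    exact conj_lemma _ L rfl hL m m hm (hA _ hg _ hmA)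
  have : A = (A.comap (CoprodI.of : H i →* CoprodI H)).map CoprodI.of := by
    rw [Subgroup.map_comap_eq, inf_eq_right.2 hle]
  rw [this]
  refine fg_map _ (h i _ ⟨⟨?_⟩⟩)
  rintro ⟨x, hx⟩ ⟨y, hy⟩
  apply Subtype.ext
  apply CoprodI.of_injective i
  simpa using hA _ hx _ hy

theorem main (h : ∀ i, ∀ A : Subgroup (H i), IsMulCommutative A → A.FG)
    {A : Subgroup (CoprodI H)} (hA : ∀ x ∈ A, ∀ y ∈ A, x * y = y * x)
    {a : List (Σ i, H i)} (ha : Red a) (ha0 : a ≠ []) (haA : P a ∈ A)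
    (hmin : ∀ g : CoprodI H, ∀ L : List (Σ i, H i), Red L → L ≠ [] → g * P L * g⁻¹ ∈ A →
      a.length ≤ L.length) : A.FG := by
  by_cases hcyc : ∀ u ∈ a.getLast?, ∀ v ∈ a.head?, u.1 ≠ v.1
  · rw [cyclic_case ha ha0 hcyc haA (fun x hx => hA _ haA _ hx)
      (fun L hL h0 hLA => hmin 1 L hL h0 (by simpa using hLA))]
    exact ⟨{P a}, by simp [Subgroup.zpowers_eq_closure]⟩
  rcases a with _ | ⟨⟨i, m⟩, b⟩
  · exact absurd rfl ha0
  rcases b.eq_nil_or_concat with rfl | ⟨c, ⟨j, m'⟩, rfl⟩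
  · exact factor_case h hA (ha.1 ⟨i, m⟩ (by simp)) (by simpa [P_single] using haA)
  exfalso
  rw [List.concat_eq_append] at *
  have hji : j = i := by
    by_contra hne
    apply hcyc
    intro u hu v hv
    rw [← List.cons_append, List.getLast?_concat] at hu
    simp only [List.head?_cons, Option.mem_def, Option.some.injEq] at hu hv
    subst hu hv
    exact hne
  subst hji
  have hr1 : Red ([⟨j, m⟩] ++ (c ++ [(⟨j, m'⟩ : Σ i, H i)])) := ha
  have hr2 := (red_append.1 hr1).2.1
  have hr3 := red_append.1 hr2
  have hc0 : c ≠ [] := by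
    rintro rfl
    exact (red_append.1 hr1).2.2 ⟨j, m⟩ (by simp) ⟨j, m'⟩ (by simp) rfl
  have hP : P (⟨j, m⟩ :: (c ++ [(⟨j, m'⟩ : Σ i, H i)])) =
      CoprodI.of m * (P c * CoprodI.of (m' * m)) * (CoprodI.of m)⁻¹ := by
    rw [P_cons, P_append, P_single]; simp [mul_assoc]
  rw [hP] at haA
  by_cases h1 : m' * m = 1
  · have := hmin (CoprodI.of m) c hr3.1 hc0 (by simpa [h1] using haA)
    simp at this
  · have := hmin (CoprodI.of m) (c ++ [⟨j, m' * m⟩])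
      (red_append.2 ⟨hr3.1, red_single h1, by simpa using hr3.2.2⟩) (by simp)
      (by simpa only [P_append, P_single] using haA)
    simp at this

end FreeProdAb

/-- If every abelian subgroup of each group `H i` is finitely generated, then every
abelian subgroup of the free product `∗ᵢ Hᵢ` is finitely generated. -/
theorem stmt_11 {ι : Type*} (H : ι → Type*) [∀ i, Group (H i)]
    (h : ∀ i, ∀ A : Subgroup (H i), IsMulCommutative A → A.FG) :
    ∀ A : Subgroup (Monoid.CoprodI H), IsMulCommutative A → A.FG := by
  intro A hA
  classical
  have hcomm : ∀ x ∈ A, ∀ y ∈ A, x * y = y * x := fun x hx y hy =>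
    congrArg Subtype.val (hA.is_comm.comm (⟨x, hx⟩ : A) ⟨y, hy⟩)
  by_cases hbot : A = ⊥
  · rw [hbot]; exact ⟨∅, by simp⟩
  have hex : ∃ n : ℕ, ∃ g : Monoid.CoprodI H, ∃ L : List (Σ i, H i), FreeProdAb.Red L ∧ L ≠ [] ∧
      g * FreeProdAb.P L * g⁻¹ ∈ A ∧ L.length = n := by
    obtain ⟨x, hx, hx1⟩ := A.ne_bot_iff_exists_ne_one.1 hbot |>.imp (fun x hx => hx) |> fun ⟨x, hx⟩ =>
      (⟨x.1, x.2, fun h => hx (Subtype.ext h)⟩ : ∃ x, x ∈ A ∧ x ≠ 1)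
    obtain ⟨L, hL, rfl⟩ := FreeProdAb.exists_red x
    exact ⟨_, 1, L, hL, by rintro rfl; exact hx1 rfl, by simpa using hx, rfl⟩
  obtain ⟨g, a, ha, ha0, haA, hlen⟩ := Nat.find_spec hex
  have hB : (A.comap (MulAut.conj g).toMonoidHom).FG := by
    refine FreeProdAb.main h ?_ ha ha0 (by simpa using haA) ?_
    · intro x hx y hy
      apply (MulAut.conj g).injective
      have := hcomm _ hx _ hy
      rw [map_mul, map_mul]
      exact this
    · intro k L hL h0 hk
      rw [hlen]
      refine Nat.find_min' hex ⟨g * k, L, hL, h0, ?_, rfl⟩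
      simpa [mul_assoc] using hk
  have := FreeProdAb.fg_map (MulAut.conj g).toMonoidHom hB
  rwa [Subgroup.map_comap_eq_self_of_surjective (MulAut.conj g).surjective] at this
end

section
/- Every abelian subgroup A of a free product ∗ᵢ Hᵢ of a family of groups (Hᵢ)_{i∈ι} is either cyclic or conjugate to a subgroup of one of the factors; that is, either A is cyclic, or there exist an index i and an element g of the free product such that gAg⁻¹ is contained in the canonical image of Hᵢ in ∗ᵢ Hᵢ. -/
namespace FP

open Monoid

variable {ι : Type*} {H : ι → Type*} [∀ i, Group (H i)]

/-- Reduced lists of letters. -/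
def Red (l : List (Σ i, H i)) : Prop :=
  (∀ x ∈ l, x.2 ≠ 1) ∧ l.IsChain (fun a b => a.1 ≠ b.1)

/-- Product of a list of letters. -/
def P (l : List (Σ i, H i)) : CoprodI H := (l.map fun s => CoprodI.of s.2).prod

@[simp] lemma P_nil : P ([] : List (Σ i, H i)) = 1 := rfl

@[simp] lemma P_cons (s : Σ i, H i) (l : List (Σ i, H i)) :
    P (s :: l) = CoprodI.of s.2 * P l := by simp [P]

@[simp] lemma P_append (l l' : List (Σ i, H i)) : P (l ++ l') = P l * P l' := by simp [P]

lemma Red.left {l t : List (Σ i, H i)} (h : Red (l ++ t)) : Red l :=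
  ⟨fun x hx => h.1 x (by simp [hx]), (List.isChain_append.1 h.2).1⟩

lemma Red.right {l t : List (Σ i, H i)} (h : Red (l ++ t)) : Red t :=
  ⟨fun x hx => h.1 x (by simp [hx]), (List.isChain_append.1 h.2).2.1⟩

lemma red_cons_cons {a b : Σ i, H i} {l : List (Σ i, H i)} :
    Red (a :: b :: l) ↔ a.2 ≠ 1 ∧ a.1 ≠ b.1 ∧ Red (b :: l) := by
  simp only [Red, List.isChain_cons_cons, List.forall_mem_cons]
  tauto

lemma red_singleton {a : Σ i, H i} : Red [a] ↔ a.2 ≠ 1 := by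
  simp [Red]

lemma red_replace_head {i : ι} {y z : H i} {l : List (Σ i, H i)}
    (h : Red (⟨i, y⟩ :: l)) (hz : z ≠ 1) : Red (⟨i, z⟩ :: l) := by
  cases l with
  | nil => exact red_singleton.2 hz
  | cons b l =>
    rw [red_cons_cons] at h ⊢
    exact ⟨hz, h.2⟩

lemma exists_red (g : CoprodI H) : ∃ l, Red l ∧ P l = g := by
  classical
  refine ⟨(CoprodI.Word.equiv g).toList, ⟨fun x hx => (CoprodI.Word.equiv g).ne_one x hx,
    (CoprodI.Word.equiv g).chain_ne⟩, ?_⟩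
  exact CoprodI.Word.equiv.symm_apply_apply g

lemma red_unique {l l' : List (Σ i, H i)} (h : Red l) (h' : Red l') (e : P l = P l') :
    l = l' := by
  classical
  let w : CoprodI.Word H := ⟨l, fun x hx => h.1 x hx, h.2⟩
  let w' : CoprodI.Word H := ⟨l', fun x hx => h'.1 x hx, h'.2⟩
  have : w = w' := CoprodI.Word.equiv.symm.injective e
  exact congrArg CoprodI.Word.toList this

/-- Formal inverse. -/
def linv (l : List (Σ i, H i)) : List (Σ i, H i) :=
  (l.map fun s => (⟨s.1, s.2⁻¹⟩ : Σ i, H i)).reverse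

lemma linv_append (l t : List (Σ i, H i)) : linv (l ++ t) = linv t ++ linv l := by
  simp [linv]

lemma linv_linv (l : List (Σ i, H i)) : linv (linv l) = l := by
  simp [linv, Function.comp_def]

lemma linv_length (l : List (Σ i, H i)) : (linv l).length = l.length := by
  simp [linv]

lemma P_linv (l : List (Σ i, H i)) : P (linv l) = (P l)⁻¹ := by
  induction l with
  | nil => simp [linv]
  | cons a l ih =>
    have : linv (a :: l) = linv l ++ [⟨a.1, a.2⁻¹⟩] := by simp [linv]
    rw [this, P_append, ih]
    simp

lemma Red.linv {l : List (Σ i, H i)} (h : Red l) : Red (linv l) := by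
  refine ⟨?_, ?_⟩
  · intro x hx
    simp only [FP.linv, List.mem_reverse, List.mem_map] at hx
    obtain ⟨s, hs, rfl⟩ := hx
    simpa using h.1 s hs
  · rw [FP.linv, List.isChain_reverse, List.isChain_map]
    exact h.2.imp fun a b hab => Ne.symm hab

lemma left_mul (g : CoprodI H) : ∃ m : ℕ, ∀ l : List (Σ i, H i), m ≤ l.length →
    ∃ c, ∀ t, Red (l ++ t) → Red (c ++ t) ∧ P (c ++ t) = g * P (l ++ t) := by
  classical
  induction g using CoprodI.induction_left with
  | one => exact ⟨0, fun l _ => ⟨l, fun t h => ⟨h, by simp⟩⟩⟩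
  | mul h g' ih =>
    rename_i i
    obtain ⟨m, hm⟩ := ih
    refine ⟨m + 1, fun l hl => ?_⟩
    rcases List.eq_nil_or_concat l with rfl | ⟨l1, e, rfl⟩
    · simp at hl
    obtain ⟨c1, hc1⟩ := hm l1 (by simpa using hl)
    have key : ∀ t, Red (l1 ++ [e] ++ t) → Red ((c1 ++ [e]) ++ t) ∧
        P ((c1 ++ [e]) ++ t) = g' * P (l1 ++ [e] ++ t) := by
      intro t ht
      have := hc1 ([e] ++ t) (by simpa using ht)
      simpa using this
    obtain ⟨a, l', hal⟩ : ∃ a l', c1 ++ [e] = a :: l' := by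
      cases c1 with
      | nil => exact ⟨_, _, rfl⟩
      | cons a l => exact ⟨_, _, rfl⟩
    rw [hal] at key
    by_cases h1 : h = 1
    · subst h1
      refine ⟨a :: l', fun t ht => ?_⟩
      simpa using key t (by simpa using ht)
    obtain ⟨j, y⟩ := a
    by_cases hij : i = j
    · subst hij
      by_cases hy : h * y = 1
      · refine ⟨l', fun t ht => ?_⟩
        obtain ⟨k1, k2⟩ := key t (by simpa using ht)
        refine ⟨Red.right (l := [⟨i, y⟩]) k1, ?_⟩
        have : l1.concat e ++ t = l1 ++ [e] ++ t := by simp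
        rw [this, mul_assoc, ← k2, List.cons_append, P_cons, ← mul_assoc, ← map_mul, hy]
        simp
      · refine ⟨⟨i, h * y⟩ :: l', fun t ht => ?_⟩
        obtain ⟨k1, k2⟩ := key t (by simpa using ht)
        refine ⟨red_replace_head k1 hy, ?_⟩
        have : l1.concat e ++ t = l1 ++ [e] ++ t := by simp
        rw [this, mul_assoc, ← k2, List.cons_append, P_cons, List.cons_append, P_cons,
          ← mul_assoc, ← map_mul]
    · refine ⟨⟨i, h⟩ :: ⟨j, y⟩ :: l', fun t ht => ?_⟩
      obtain ⟨k1, k2⟩ := key t (by simpa using ht)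
      refine ⟨red_cons_cons.2 ⟨h1, hij, k1⟩, ?_⟩
      have : l1.concat e ++ t = l1 ++ [e] ++ t := by simp
      rw [this, mul_assoc, ← k2, List.cons_append, P_cons]

lemma right_mul (g : CoprodI H) : ∃ m : ℕ, ∀ t : List (Σ i, H i), m ≤ t.length →
    ∃ c, ∀ l, Red (l ++ t) → Red (l ++ c) ∧ P (l ++ c) = P (l ++ t) * g := by
  obtain ⟨m, hm⟩ := left_mul g⁻¹
  refine ⟨m, fun t ht => ?_⟩
  obtain ⟨c, hc⟩ := hm (linv t) (by rwa [linv_length])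
  refine ⟨linv c, fun l hl => ?_⟩
  have h1 := hl.linv
  rw [linv_append] at h1
  obtain ⟨k1, k2⟩ := hc (linv l) h1
  have e : l ++ linv c = linv (c ++ linv l) := by rw [linv_append, linv_linv]
  rw [e]
  refine ⟨k1.linv, ?_⟩
  rw [P_linv, k2, ← linv_append, P_linv]
  simp

lemma red_append_singleton_iff {l : List (Σ i, H i)} {a b : Σ i, H i} :
    Red (l ++ [a] ++ [b]) ↔ Red (l ++ [a]) ∧ a.1 ≠ b.1 ∧ b.2 ≠ 1 := by
  simp only [Red, List.isChain_append (l₂ := [b]), List.forall_mem_append]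
  simp
  tauto

lemma red_replace_last {i : ι} {y z : H i} {l : List (Σ i, H i)}
    (h : Red (l ++ [⟨i, y⟩])) (hz : z ≠ 1) : Red (l ++ [⟨i, z⟩]) := by
  rcases List.eq_nil_or_concat l with rfl | ⟨l1, e, rfl⟩
  · exact red_singleton.2 hz
  · rw [List.concat_eq_append] at h ⊢
    rw [red_append_singleton_iff] at h ⊢
    exact ⟨h.1, h.2.1, hz⟩

/-- Any element decomposes as a letter in `H i` times a reduced word not starting in `H i`. -/
lemma split_head (i : ι) (b : CoprodI H) : ∃ (x : H i) (l : List (Σ i, H i)),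
    b = CoprodI.of x * P l ∧ Red l ∧ ∀ z : H i, z ≠ 1 → Red (⟨i, z⟩ :: l) := by
  classical
  obtain ⟨l, hl, rfl⟩ := exists_red b
  cases l with
  | nil => exact ⟨1, [], by simp, hl, fun z hz => red_singleton.2 hz⟩
  | cons a l =>
    obtain ⟨j, y⟩ := a
    by_cases hij : i = j
    · subst hij
      exact ⟨y, l, by simp, Red.right (l := [⟨i, y⟩]) hl, fun z hz => red_replace_head hl hz⟩
    · exact ⟨1, ⟨j, y⟩ :: l, by simp, hl, fun z hz => red_cons_cons.2 ⟨hz, hij, hl⟩⟩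

lemma centralizer_of {i : ι} {h : H i} (h1 : h ≠ 1) {b : CoprodI H}
    (hb : b * CoprodI.of h = CoprodI.of h * b) :
    b ∈ (CoprodI.of : H i →* CoprodI H).range := by
  classical
  obtain ⟨x, l, rfl, hl, hcons⟩ := split_head i b
  have hz : x⁻¹ * h * x ≠ 1 := by
    intro hh
    apply h1
    have : h = x * (x⁻¹ * h * x) * x⁻¹ := by group
    rw [this, hh]; simp
  have hR := hcons _ hz
  have e : P (⟨i, x⁻¹ * h * x⟩ :: l) = P l * CoprodI.of h := by
    rw [P_cons]
    simp only [map_mul, map_inv]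
    rw [mul_assoc, mul_assoc, ← hb.trans (mul_assoc _ _ _).symm |>.trans (mul_assoc _ _ _)]
    group
  rcases List.eq_nil_or_concat l with rfl | ⟨l1, ⟨j, y⟩, rfl⟩
  · exact ⟨x, by simp⟩
  exfalso
  rw [List.concat_eq_append] at *
  by_cases hij : j = i
  · subst hij
    by_cases hy : y * h = 1
    · have e2 : P (⟨j, x⁻¹ * h * x⟩ :: (l1 ++ [⟨j, y⟩])) = P l1 := by
        rw [e, P_append, mul_assoc, P_cons, P_nil, mul_one, ← map_mul, hy]; simp
      have := congrArg List.length (red_unique hR hl.left e2)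
      simp at this
      omega
    · have e2 : P (⟨j, x⁻¹ * h * x⟩ :: (l1 ++ [⟨j, y⟩])) = P (l1 ++ [⟨j, y * h⟩]) := by
        rw [e, P_append, mul_assoc, P_cons, P_nil, mul_one, ← map_mul]; simp
      have := congrArg List.length (red_unique hR (red_replace_last hl hy) e2)
      simp at this
  · have hR2 : Red (l1 ++ [⟨j, y⟩] ++ [⟨i, h⟩]) := red_append_singleton_iff.2 ⟨hl, hij, h1⟩
    have e2 := red_unique hR hR2 (by rw [e]; simp [mul_assoc])
    cases l1 with
    | nil =>
      simp at e2
      exact hij e2.1.1.symm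
    | cons a l1 =>
      simp only [List.cons_append, List.cons.injEq] at e2 hR
      have := (red_cons_cons.1 hR).2.1
      exact this (by rw [← e2.1])

lemma cyc_red (n : ℕ) : ∀ l : List (Σ i, H i), l.length ≤ n → l ≠ [] → Red l →
    ∃ g : CoprodI H, (∃ (i : ι) (h : H i), g * P l * g⁻¹ = CoprodI.of h) ∨
      ∃ w, w ≠ [] ∧ Red (w ++ w) ∧ g * P l * g⁻¹ = P w := by
  classical
  induction n with
  | zero =>
    intro l hl h0
    exact absurd (List.length_eq_zero_iff.1 (by omega)) h0
  | succ n ih =>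
    intro l hl h0 hred
    cases l with
    | nil => exact absurd rfl h0
    | cons a l =>
    rcases List.eq_nil_or_concat l with rfl | ⟨l1, ⟨j, y⟩, rfl⟩
    · exact ⟨1, Or.inl ⟨a.1, a.2, by simp⟩⟩
    rw [List.concat_eq_append] at *
    obtain ⟨i, x⟩ := a
    by_cases hij : j = i
    · subst hij
      have hl1 : Red (l1 ++ [⟨j, y⟩]) := Red.right (l := [⟨j, x⟩]) hred
      have e : (CoprodI.of x)⁻¹ * P (⟨j, x⟩ :: (l1 ++ [⟨j, y⟩])) * (CoprodI.of x)⁻¹⁻¹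
          = P (l1 ++ [⟨j, y * x⟩]) := by
        simp [mul_assoc]
      by_cases hy : y * x = 1
      · by_cases hn : l1 = []
        · subst hn
          exact ⟨(CoprodI.of x)⁻¹, Or.inl ⟨j, y * x, by rw [e]; simp⟩⟩
        · obtain ⟨g, hg⟩ := ih l1 (by simp at hl; omega) hn hl1.left
          have e2 : P (l1 ++ [⟨j, y * x⟩]) = P l1 := by simp only [P_append, P_cons, hy]; simp
          rw [e2] at e
          refine ⟨g * (CoprodI.of x)⁻¹, ?_⟩
          rw [← e] at hg
          simpa [mul_assoc] using hg
      · obtain ⟨g, hg⟩ := ih (l1 ++ [⟨j, y * x⟩]) (by simp at hl ⊢; omega) (by simp)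
          (red_replace_last hl1 hy)
        refine ⟨g * (CoprodI.of x)⁻¹, ?_⟩
        rw [← e] at hg
        simpa [mul_assoc] using hg
    · refine ⟨1, Or.inr ⟨_, h0, ?_, by simp⟩⟩
      refine ⟨fun z hz => hred.1 z ((List.mem_append.1 hz).elim id id), ?_⟩
      rw [List.isChain_append]
      refine ⟨hred.2, hred.2, ?_⟩
      intro p hp q hq
      rw [← List.cons_append, List.getLast?_append] at hp
      simp at hp hq
      subst hp hq
      exact hij

section periodic

variable (ξ : ℕ → Σ i, H i)

/-- Prefixes of an infinite word. -/
def X (n : ℕ) : List (Σ i, H i) := (List.range n).map ξ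

/-- Segment. -/
def Y (m n : ℕ) : List (Σ i, H i) := (List.range n).map fun k => ξ (m + k)

lemma X_add (m n : ℕ) : X ξ (m + n) = X ξ m ++ Y ξ m n := by
  simp [X, Y, List.range_add, Function.comp_def]

lemma Y_add (m n k : ℕ) : Y ξ m (n + k) = Y ξ m n ++ Y ξ (m + n) k := by
  simp [Y, List.range_add, Function.comp_def, add_assoc]

lemma X_length (n : ℕ) : (X ξ n).length = n := by simp [X]

lemma Y_length (m n : ℕ) : (Y ξ m n).length = n := by simp [Y]

variable {ξ}

lemma red_X (h1 : ∀ n, (ξ n).2 ≠ 1) (h2 : ∀ n, (ξ n).1 ≠ (ξ (n + 1)).1) (n : ℕ) :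
    Red (X ξ n) := by
  refine ⟨fun x hx => ?_, ?_⟩
  · simp only [X, List.mem_map] at hx
    obtain ⟨k, -, rfl⟩ := hx
    exact h1 k
  · rw [List.isChain_iff_getElem]
    intro i hi
    simp [X, h2]

lemma commute_shift (h1 : ∀ n, (ξ n).2 ≠ 1) (h2 : ∀ n, (ξ n).1 ≠ (ξ (n + 1)).1)
    {L : ℕ} (hL : 0 < L) (hper : ∀ n, P (X ξ (L + n)) = P (X ξ L) * P (X ξ n))
    {b : CoprodI H} (hb : Commute b (P (X ξ L))) :
    ∃ p q : ℕ, ∀ n, b * P (X ξ (p + n)) = P (X ξ (q + n)) := by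
  have hpow : ∀ q : ℕ, P (X ξ (q * L)) = P (X ξ L) ^ q := by
    intro q
    induction q with
    | zero => simp [X]
    | succ q ih => rw [add_mul, one_mul, add_comm, hper, ih, pow_succ']
  obtain ⟨m, hm⟩ := left_mul b
  obtain ⟨m2, hm2⟩ := right_mul b
  obtain ⟨c, hc⟩ := hm (X ξ m) (by rw [X_length])
  refine ⟨m, c.length, fun n => ?_⟩
  have hcn := hc (Y ξ m n) (by rw [← X_add]; exact red_X h1 h2 _)
  rw [X_add, ← hcn.2]
  congr 1
  -- big power
  obtain ⟨q, hq⟩ : ∃ q : ℕ, m2 + m + c.length + n ≤ q * L :=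
    ⟨m2 + m + c.length + n, Nat.le_mul_of_pos_right _ hL⟩
  obtain ⟨r, hr⟩ : ∃ r, q * L = m + (n + r) := ⟨q * L - m - n, by omega⟩
  obtain ⟨s, hs⟩ : ∃ s, q * L = ((c.length + n) + s) + m2 :=
    ⟨q * L - m2 - (c.length + n), by omega⟩
  obtain ⟨c', hc'⟩ := hm2 (Y ξ (c.length + n + s) m2) (by rw [Y_length])
  have A1 := hc (Y ξ m (n + r)) (by rw [← X_add]; exact red_X h1 h2 _)
  have A2 := hc' (X ξ (c.length + n + s)) (by rw [← X_add]; exact red_X h1 h2 _)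
  rw [← X_add, ← hr, hpow] at A1
  rw [← X_add, ← hs, hpow] at A2
  have E := red_unique A1.1 A2.1 (by rw [A1.2, A2.2]; exact (hb.pow_right q).eq)
  rw [Y_add, X_add, ← List.append_assoc, List.append_assoc (X ξ _)] at E
  exact (List.append_inj E (by simp [X_length, Y_length])).1

lemma X_inj (h1 : ∀ n, (ξ n).2 ≠ 1) (h2 : ∀ n, (ξ n).1 ≠ (ξ (n + 1)).1) {m n : ℕ}
    (h : P (X ξ m) = P (X ξ n)) : m = n := by
  have := congrArg List.length (red_unique (red_X h1 h2 m) (red_X h1 h2 n) h)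
  simpa [X_length] using this

lemma cyclic_of_shift (h1 : ∀ n, (ξ n).2 ≠ 1) (h2 : ∀ n, (ξ n).1 ≠ (ξ (n + 1)).1)
    {A : Type*} [Group A] (φ : A →* CoprodI H) (hφ : Function.Injective φ)
    (hsh : ∀ a, ∃ p q : ℕ, ∀ n, φ a * P (X ξ (p + n)) = P (X ξ (q + n))) : IsCyclic A := by
  choose p q hpq using hsh
  have uniq : ∀ (b : CoprodI H) (p q p' q' : ℕ),
      (∀ n, b * P (X ξ (p + n)) = P (X ξ (q + n))) →
      (∀ n, b * P (X ξ (p' + n)) = P (X ξ (q' + n))) → (q : ℤ) - p = q' - p' := by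
    intro b p q p' q' h h'
    have e1 := h p'
    have e2 := h' p
    rw [add_comm p' p, e1] at e2
    have := X_inj h1 h2 e2
    omega
  let f : A →* Multiplicative ℤ := MonoidHom.mk' (fun a => Multiplicative.ofAdd ((q a : ℤ) - p a))
    (by
      intro a b
      rw [← ofAdd_add]
      congr 1
      have := uniq (φ (a * b)) (p (a * b)) (q (a * b)) (p a + p b) (q a + q b) (hpq _) (by
        intro n
        rw [map_mul, mul_assoc, show p a + p b + n = p b + (p a + n) by ring, hpq b,
          show q b + (p a + n) = p a + (q b + n) by ring, hpq a]
        congr 2; ring)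
      push_cast at this
      rw [this]; ring)
  refine isCyclic_of_injective f ?_
  rw [injective_iff_map_eq_one]
  intro a ha
  have h0 : (q a : ℤ) - p a = 0 := ha
  have h3 : q a = p a := by omega
  have := hpq a 0
  rw [h3] at this
  apply hφ
  rw [map_one]
  exact mul_eq_right.1 this

end periodic

lemma exists_periodic {w : List (Σ i, H i)} (hw : w ≠ []) (hred : Red (w ++ w)) :
    ∃ ξ : ℕ → Σ i, H i, (∀ n, (ξ n).2 ≠ 1) ∧ (∀ n, (ξ n).1 ≠ (ξ (n + 1)).1) ∧
      X ξ w.length = w ∧ ∀ n, P (X ξ (w.length + n)) = P (X ξ w.length) * P (X ξ n) := by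
  have hL : 0 < w.length := List.length_pos_iff.2 hw
  refine ⟨fun n => w[n % w.length]'(Nat.mod_lt _ hL), ?_, ?_, ?_, ?_⟩
  · intro n
    exact hred.1 _ (by simp)
  · intro n
    have hlt := Nat.mod_lt n hL
    have hc := List.isChain_iff_getElem.1 hred.2 (n % w.length) (by simp; omega)
    rw [List.getElem_append_left hlt] at hc
    by_cases hlt2 : n % w.length + 1 < w.length
    · rw [List.getElem_append_left hlt2] at hc
      have e : (n + 1) % w.length = n % w.length + 1 := by
        rw [Nat.add_mod, Nat.mod_eq_of_lt (show 1 < w.length by omega), Nat.mod_eq_of_lt hlt2]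
      simpa only [e] using hc
    · rw [List.getElem_append_right (by omega)] at hc
      have e0 : n % w.length + 1 = w.length := by omega
      have e : (n + 1) % w.length = 0 := by
        rw [← Nat.mod_add_mod, e0, Nat.mod_self]
      simpa only [e, e0, Nat.sub_self] using hc
  · apply List.ext_getElem
    · simp [X]
    · intro i hi hi'
      simp [X, Nat.mod_eq_of_lt hi']
  · intro n
    rw [X_add, P_append]
    congr 2
    simp [X, Y]

end FP

/-- Every abelian subgroup `A` of a free product `∗ᵢ Hᵢ` is either cyclic or conjugate
to a subgroup of one of the factors: there are an index `i` and an element `g` of the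
free product with `gAg⁻¹` contained in the canonical image of `Hᵢ`. -/
theorem stmt_12 {ι : Type*} (H : ι → Type*) [∀ i, Group (H i)]
    (A : Subgroup (Monoid.CoprodI H)) (hA : IsMulCommutative A) :
    IsCyclic A ∨ ∃ (i : ι) (g : Monoid.CoprodI H),
      ∀ a ∈ A, g * a * g⁻¹ ∈ (Monoid.CoprodI.of : H i →* Monoid.CoprodI H).range := by
  classical
  by_cases htriv : ∀ a ∈ A, a = 1
  · left
    have : Subsingleton A := ⟨fun a b => Subtype.ext ((htriv a a.2).trans (htriv b b.2).symm)⟩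
    infer_instance
  push Not at htriv
  obtain ⟨a, haA, ha1⟩ := htriv
  have hcomm : ∀ b ∈ A, b * a = a * b := by
    intro b hb
    exact congrArg Subtype.val (hA.is_comm.comm (⟨b, hb⟩ : A) ⟨a, haA⟩)
  obtain ⟨l, hl, rfl⟩ := FP.exists_red a
  have hl0 : l ≠ [] := by
    rintro rfl
    exact ha1 rfl
  obtain ⟨g, ⟨i, h, hg⟩ | ⟨w, hw, hww, hg⟩⟩ := FP.cyc_red l.length l le_rfl hl0 hl
  · right
    refine ⟨i, g, fun b hb => ?_⟩
    have h1 : h ≠ 1 := by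
      rintro rfl
      rw [map_one] at hg
      exact ha1 (conj_eq_one_iff.1 hg)
    apply FP.centralizer_of h1
    rw [← hg]
    have := congrArg (fun z => g * z * g⁻¹) (hcomm b hb)
    simpa [mul_assoc] using this
  · left
    obtain ⟨ξ, k1, k2, k3, k4⟩ := FP.exists_periodic hw hww
    refine FP.cyclic_of_shift k1 k2 ((MulAut.conj g).toMonoidHom.comp A.subtype)
      ((MulAut.conj g).injective.comp A.subtype_injective) ?_
    intro b
    refine FP.commute_shift k1 k2 (List.length_pos_iff.2 hw) k4 ?_
    rw [k3, ← hg]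
    have := congrArg (fun z => g * z * g⁻¹) (hcomm b b.2)
    simpa [Commute, SemiconjBy, mul_assoc] using this
end

section
/- Let G be a discrete subgroup of GL(n, ℝ), i.e., a subgroup that is discrete in the topology induced from GL(n, ℝ). Then every abelian subgroup of G is finitely generated. -/
open NormedSpace Topology in
theorem aux_range_nhds_one {R : Type*} [NormedRing R] [NormedAlgebra ℂ R] [CompleteSpace R] :
    Set.range (exp : R → R) ∈ 𝓝 (1 : R) := by
  have h : HasStrictFDerivAt (exp : R → R)
      ((ContinuousLinearEquiv.refl ℂ R : R ≃L[ℂ] R) : R →L[ℂ] R) 0 :=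
    hasStrictFDerivAt_exp_zero (𝕂 := ℂ)
  have h2 := h.map_nhds_eq_of_equiv
  rw [exp_zero] at h2
  rw [← h2]
  exact Filter.mem_map.2 (Filter.univ_mem' fun x => ⟨x, rfl⟩)

open NormedSpace Topology in
theorem aux_inj_nhds_zero {R : Type*} [NormedRing R] [NormedAlgebra ℂ R] [CompleteSpace R] :
    ∀ᶠ x in 𝓝 (0 : R), exp x = 1 → x = 0 := by
  have h : HasStrictFDerivAt (exp : R → R)
      ((ContinuousLinearEquiv.refl ℂ R : R ≃L[ℂ] R) : R →L[ℂ] R) 0 :=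
    hasStrictFDerivAt_exp_zero (𝕂 := ℂ)
  have h2 := h.eventually_left_inverse
  have h0 := h.localInverse_apply_image
  rw [exp_zero] at h0
  filter_upwards [h2] with x hx h1
  rw [← hx, h1, h0]

theorem aux_spectrum_finite {R : Type*} [Ring R] [Algebra ℂ R] [FiniteDimensional ℂ R] (x : R) :
    (spectrum ℂ x).Finite := by
  nontriviality R
  have hx : IsIntegral ℂ x := Algebra.IsIntegral.isIntegral x
  refine ((minpoly ℂ x).rootSet_finite ℂ).subset ?_
  intro z hz
  have := spectrum.subset_polynomial_aeval x (minpoly ℂ x) ⟨z, hz, rfl⟩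
  rw [minpoly.aeval, spectrum.zero_eq] at this
  rw [Polynomial.mem_rootSet]
  exact ⟨minpoly.ne_zero hx, by simpa using this⟩

open NormedSpace Topology in
theorem aux_exp_surj {R : Type*} [NormedRing R] [NormedAlgebra ℂ R] [FiniteDimensional ℂ R]
    (hc : ∀ x y : R, x * y = y * x) (u : R) (hu : IsUnit u) : ∃ x : R, exp x = u := by
  have : CompleteSpace R := FiniteDimensional.complete ℂ R
  let : NormedAlgebra ℚ R := NormedAlgebra.restrictScalars ℚ ℂ R
  have hexp : ∀ x y : R, exp (x + y) = exp x * exp y := fun x y => exp_add_of_commute (hc x y)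
  -- translate neighbourhoods
  have hnb : ∀ v : Rˣ, ∀ᶠ y in 𝓝 (v : R), (↑v⁻¹ : R) * y ∈ Set.range (exp : R → R) := by
    intro v
    have hcont : ContinuousAt (fun y : R => (↑v⁻¹ : R) * y) v := by fun_prop
    refine hcont.eventually_mem ?_
    simpa using aux_range_nhds_one (R := R)
  let g : ℂ → R := fun z => 1 + z • (u - 1)
  have hg : Continuous g := by fun_prop
  let S : Set ℂ := {z | IsUnit (g z)}
  let T : Set ℂ := {z | g z ∈ Set.range (exp : R → R)}
  let T' : Set ℂ := {z | IsUnit (g z) ∧ g z ∉ Set.range (exp : R → R)}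
  have hSfin : Sᶜ.Finite := by
    have hfin := aux_spectrum_finite (u - 1)
    refine (hfin.image (fun z => -z⁻¹)).subset ?_
    intro z hz
    have hz : ¬ IsUnit (1 + z • (u - 1)) := hz
    have hz0 : z ≠ 0 := by
      rintro rfl
      simp at hz
    refine ⟨-z⁻¹, ?_, by simp⟩
    rw [spectrum.mem_iff]
    intro hun
    apply hz
    have h3 : (1 : R) + z • (u - 1) = algebraMap ℂ R (-z) * (algebraMap ℂ R (-z⁻¹) - (u - 1)) := by
      rw [mul_sub, ← map_mul, ← Algebra.smul_def]
      simp [hz0]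
    rw [h3]
    exact ((isUnit_iff_ne_zero.2 (neg_ne_zero.2 hz0)).map (algebraMap ℂ R)).mul hun
  have hS : IsPreconnected S := by
    have := (hSfin.countable.isConnected_compl_of_one_lt_rank
      (by rw [Complex.rank_real_complex]; exact Nat.one_lt_ofNat)).isPreconnected
    simpa using this
  have hT : IsOpen T := by
    have : IsOpen (Set.range (exp : R → R)) := by
      rw [isOpen_iff_mem_nhds]
      rintro _ ⟨x, rfl⟩
      obtain ⟨v, hv⟩ := isUnit_exp x
      rw [← hv]
      filter_upwards [hnb v] with y hy
      obtain ⟨w, hw⟩ := hy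
      refine ⟨x + w, ?_⟩
      rw [hexp, hw, ← hv, Units.mul_inv_cancel_left]
    exact this.preimage hg
  have hT' : IsOpen T' := by
    have : IsOpen {y : R | IsUnit y ∧ y ∉ Set.range (exp : R → R)} := by
      rw [isOpen_iff_mem_nhds]
      rintro _ ⟨⟨v, rfl⟩, hv⟩
      filter_upwards [hnb v, Units.isOpen.mem_nhds ⟨v, rfl⟩] with y hy hyu
      refine ⟨hyu, ?_⟩
      rintro ⟨x, rfl⟩
      obtain ⟨w, hw⟩ := hy
      apply hv
      refine ⟨x + -w, ?_⟩
      have e1 : exp w * exp (-w) = (1 : R) := by rw [← hexp]; simp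
      have e2 : exp x = v * exp w := by rw [hw, Units.mul_inv_cancel_left]
      rw [hexp, e2, mul_assoc, e1, mul_one]
    exact this.preimage hg
  have h0 : (0 : ℂ) ∈ T := ⟨0, by simp [g]⟩
  have h0S : (0 : ℂ) ∈ S := by simp [S, g]
  have h1S : (1 : ℂ) ∈ S := by simpa [S, g] using hu
  have key := isPreconnected_iff_subset_of_disjoint.1 hS T T' hT hT'
    (fun z hz => by
      by_cases h : g z ∈ Set.range (exp : R → R)
      · exact Or.inl h
      · exact Or.inr ⟨hz, h⟩)
    (by
      ext z
      simp only [Set.mem_inter_iff, Set.mem_empty_iff_false, iff_false]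
      rintro ⟨-, h, h'⟩
      exact h'.2 h)
  rcases key with key | key
  · obtain ⟨x, hx⟩ := key h1S
    exact ⟨x, by simpa [g] using hx⟩
  · exact absurd h0 (key h0S).2

open NormedSpace Topology in
theorem aux_fg {R : Type*} [NormedRing R] [NormedAlgebra ℂ R] [FiniteDimensional ℂ R]
    (hc : ∀ x y : R, x * y = y * x) {A : Type*} [Group A] (f : A →* R)
    (hf : ∀ᶠ y in 𝓝 (1 : R), ∀ a, f a = y → a = 1) : Group.FG A := by
  have : CompleteSpace R := FiniteDimensional.complete ℂ R
  let : NormedAlgebra ℚ R := NormedAlgebra.restrictScalars ℚ ℂ R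
  let : NormedSpace ℝ R := NormedSpace.restrictScalars ℝ ℂ R
  have : IsScalarTower ℝ ℂ R := ⟨fun a b c => by
    rw [Complex.real_smul, mul_smul]; rfl⟩
  have : FiniteDimensional ℝ R := FiniteDimensional.trans ℝ ℂ R
  have hexp : ∀ x y : R, exp (x + y) = exp x * exp y := fun x y => exp_add_of_commute (hc x y)
  have hinj : Function.Injective f := by
    rw [injective_iff_map_eq_one]
    intro a ha
    exact hf.self_of_nhds a ha
  let L : AddSubgroup R :=
    { carrier := {x | ∃ a, f a = exp x}
      zero_mem' := ⟨1, by simp⟩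
      add_mem' := by
        rintro x y ⟨a, ha⟩ ⟨b, hb⟩
        exact ⟨a * b, by rw [map_mul, ha, hb, hexp]⟩
      neg_mem' := by
        rintro x ⟨a, ha⟩
        refine ⟨a⁻¹, ?_⟩
        have e1 : exp x * exp (-x) = (1 : R) := by rw [← hexp]; simp
        have e2 : f a⁻¹ * f a = 1 := by rw [← map_mul]; simp
        rw [← mul_one (f a⁻¹), ← e1, ← ha, ← mul_assoc, e2, one_mul] }
  have hd : DiscreteTopology (AddSubgroup.toIntSubmodule L) := by
    apply discreteTopology_of_isOpen_singleton_zero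
    rw [isOpen_singleton_iff_nhds_eq_pure]
    refine le_antisymm ?_ (pure_le_nhds _)
    rw [Filter.le_pure_iff]
    have h1 : ∀ᶠ x in 𝓝 (0 : R), ∀ a, f a = exp x → a = 1 := by
      have : Filter.Tendsto (exp : R → R) (𝓝 0) (𝓝 1) := by
        simpa using (exp_continuous (𝔸 := R)).tendsto 0
      exact this.eventually hf
    have h2 : ∀ᶠ x in 𝓝 (0 : R), x ∈ L → x = 0 := by
      filter_upwards [h1, aux_inj_nhds_zero (R := R)] with x hx hx' hxL
      obtain ⟨a, ha⟩ := hxL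
      apply hx'
      rw [← ha, hx a ha, map_one]
    have h3 : Filter.Tendsto (fun x : AddSubgroup.toIntSubmodule L => (x : R)) (𝓝 0) (𝓝 0) :=
      continuous_subtype_val.tendsto _
    filter_upwards [h3.eventually h2] with x hx
    exact Subtype.ext (hx x.2)
  have hfin : Module.Finite ℤ (AddSubgroup.toIntSubmodule L) :=
    instModuleFinite_of_discrete_submodule _
  have hfg : AddGroup.FG L := by
    have : AddGroup.FG (AddSubgroup.toIntSubmodule L) := Module.Finite.iff_addGroup_fg.1 hfin
    exact this
  have : Group.FG (Multiplicative L) := inferInstance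
  choose φ hφ using fun x : L => x.2
  let Φ : Multiplicative L →* A :=
    MonoidHom.mk' (fun x => φ x.toAdd) (by
      intro x y
      apply hinj
      rw [map_mul f, hφ, hφ, hφ, ← hexp]
      rfl)
  refine Group.fg_of_surjective (f := Φ) ?_
  intro a
  obtain ⟨x, hx⟩ := aux_exp_surj hc (f a) ((Group.isUnit a).map f)
  refine ⟨Multiplicative.ofAdd ⟨x, a, hx.symm⟩, ?_⟩
  apply hinj
  change f (φ ⟨x, a, hx.symm⟩) = f a
  rw [hφ, hx]

open Topology in
theorem aux_val_nhds (n : ℕ) :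
    Filter.map (Units.val : Matrix.GeneralLinearGroup (Fin n) ℝ → Matrix (Fin n) (Fin n) ℝ) (𝓝 1)
      = 𝓝 1 := by
  open scoped Matrix.Norms.Operator in
  have ho := (Units.isOpenEmbedding_val (R := Matrix (Fin n) (Fin n) ℝ)).map_nhds_eq 1
  exact ho

open Topology in
theorem aux_fg_matrix (n : ℕ) (R : Subalgebra ℂ (Matrix (Fin n) (Fin n) ℂ))
    (hc : ∀ x y : R, x * y = y * x) {A : Type*} [Group A] (f : A →* R)
    (hf : ∀ᶠ y in 𝓝 (1 : R), ∀ a, f a = y → a = 1) : Group.FG A := by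
  open scoped Matrix.Norms.Operator in
  exact aux_fg (R := R) hc f hf

open Topology in
/-- Every abelian subgroup of a discrete subgroup `G` of `GL(n, ℝ)` is finitely
generated. -/
theorem stmt_16 (n : ℕ) (G : Subgroup (Matrix.GeneralLinearGroup (Fin n) ℝ))
    [DiscreteTopology G] :
    ∀ A : Subgroup G, IsMulCommutative A → A.FG := by
  intro A hA
  rw [← Group.fg_iff_subgroup_fg]
  let ι : Matrix (Fin n) (Fin n) ℝ →+* Matrix (Fin n) (Fin n) ℂ := Complex.ofRealHom.mapMatrix
  let F : A →* Matrix (Fin n) (Fin n) ℂ :=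
    (ι : Matrix (Fin n) (Fin n) ℝ →* Matrix (Fin n) (Fin n) ℂ).comp
      ((Units.coeHom _).comp (G.subtype.comp A.subtype))
  have hcomm : ∀ a ∈ Set.range F, ∀ b ∈ Set.range F, a * b = b * a := by
    rintro _ ⟨a, rfl⟩ _ ⟨b, rfl⟩
    rw [← map_mul, ← map_mul, hA.is_comm.comm a b]
  let R := Algebra.adjoin ℂ (Set.range F)
  have hc : ∀ x y : R, x * y = y * x := 
    (Algebra.isMulCommutative_adjoin ℂ hcomm).is_comm.comm
  let f : A →* R := F.codRestrict R (fun a => Algebra.subset_adjoin ⟨a, rfl⟩)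
  refine aux_fg_matrix n R hc f ?_
  -- discreteness
  have hG : ∀ᶠ g in 𝓝 (1 : Matrix.GeneralLinearGroup (Fin n) ℝ), g ∈ G → g = 1 := by
    have h1 : ({1} : Set G) ∈ 𝓝 (1 : G) := by simp
    rw [nhds_subtype_eq_comap, Filter.mem_comap] at h1
    obtain ⟨t, ht, hts⟩ := h1
    filter_upwards [ht] with g hg hgG
    have : (⟨g, hgG⟩ : G) ∈ ({1} : Set G) := hts hg
    exact congrArg Subtype.val this
  have hM : ∀ᶠ m in 𝓝 (1 : Matrix (Fin n) (Fin n) ℝ),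
      ∀ g : Matrix.GeneralLinearGroup (Fin n) ℝ, (g : Matrix (Fin n) (Fin n) ℝ) = m →
        g ∈ G → g = 1 := by
    have ho := aux_val_nhds n
    rw [← ho, Filter.eventually_map]
    filter_upwards [hG] with g hg g' hg'
    rw [Units.ext hg']
    exact hg
  have hre : Filter.Tendsto (fun x : R => (x : Matrix (Fin n) (Fin n) ℂ).map Complex.re)
      (𝓝 1) (𝓝 1) := by
    have : Continuous (fun x : R => (x : Matrix (Fin n) (Fin n) ℂ).map Complex.re) :=
      continuous_subtype_val.matrix_map Complex.continuous_re
    convert this.tendsto 1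
    ext i j
    by_cases h : i = j <;> simp [Matrix.one_apply, h]
  filter_upwards [hre.eventually hM] with y hy a ha
  apply Subtype.ext
  apply Subtype.ext
  refine hy _ ?_ (a : G).2
  rw [← ha]
  ext i j
  simp [f, F, ι]
end
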